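/- There exists a universal constant C > 0 such that the following holds for all d ≥ 2 and ε ∈ (0,1). Let f : {0,1}^d → ℝ be ε-far from monotone (i.e., ε(f) ≥ ε) and suppose the fraction of directed hypercube edges violated by f is smaller than ε / sqrt(d · log d). Then there exists t ∈ {1, 2, 4, …, 2^{⌊log₂ d⌋}} such that E_S[μ_f(S)] ≥ C · ε / sqrt(d · log d), where S ⊆ [d] is a random set that includes each coordinate i ∈ [d] independently with probability 1/t. -/

import Mathlib

/-- A directed hypercube edge: `y` is obtained from `x` by flipping one coordinate
from `false` to `true`. -/
def IsEdge {d : ℕ} (x y : Fin d → Bool) : Prop :=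
  ∃ i : Fin d, x i = false ∧ y i = true ∧ ∀ j : Fin d, j ≠ i → x j = y j

/-- A function on the hypercube is monotone if it respects the coordinatewise order. -/
def MonotoneCube {d : ℕ} (g : (Fin d → Bool) → ℝ) : Prop :=
  ∀ x y : Fin d → Bool, (∀ i, x i ≤ y i) → g x ≤ g y

/-- Distance to monotonicity. -/
noncomputable def distMono (d : ℕ) (f : (Fin d → Bool) → ℝ) : ℝ :=
  ((sInf {n : ℕ | ∃ g : (Fin d → Bool) → ℝ, MonotoneCube g ∧
      n = Nat.card {x : Fin d → Bool // f x ≠ g x}} : ℕ) : ℝ) / 2 ^ d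

/-- `|S_f^-|`: the total number of violated edges of `f`. -/
noncomputable def totViol (d : ℕ) (f : (Fin d → Bool) → ℝ) : ℕ :=
  Nat.card {p : (Fin d → Bool) × (Fin d → Bool) // IsEdge p.1 p.2 ∧ f p.1 > f p.2}

/-- `x` with its `i`-th coordinate flipped. -/
def flipC {d : ℕ} (x : Fin d → Bool) (i : Fin d) : Fin d → Bool :=
  Function.update x i (!x i)

/-- The directed hypercube edge between `u` and `u^{(j)}` (directed from the endpoint
whose `j`-th coordinate is `false`) is violated by `f`. -/
def EdgeViol {d : ℕ} (f : (Fin d → Bool) → ℝ) (u : Fin d → Bool) (j : Fin d) : Prop :=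
  (u j = false ∧ f u > f (flipC u j)) ∨ (u j = true ∧ f (flipC u j) > f u)

/-- The event `Capture(x, S, f)`. -/
def Capture (d : ℕ) (f : (Fin d → Bool) → ℝ) (S : Finset (Fin d))
    (x : Fin d → Bool) : Prop :=
  ∃ i ∈ S, EdgeViol f x i ∧ ∀ j ∈ S, j ≠ i → ¬ EdgeViol f (flipC x i) j

/-- `μ_f(S)`: the probability of `Capture(x, S, f)` for uniform `x`. -/
noncomputable def muF (d : ℕ) (f : (Fin d → Bool) → ℝ) (S : Finset (Fin d)) : ℝ :=
  (Nat.card {x : Fin d → Bool // Capture d f S x} : ℝ) / 2 ^ d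

namespace CubeSort

open Finset

/-! ### Flips and sorting along a coordinate -/

lemma flipC_apply_self {d : ℕ} (x : Fin d → Bool) (i : Fin d) : flipC x i i = !x i := by
  simp [flipC]

lemma flipC_apply_ne {d : ℕ} (x : Fin d → Bool) {i j : Fin d} (h : j ≠ i) :
    flipC x i j = x j := by
  simp [flipC, h]

lemma flipC_flipC {d : ℕ} (x : Fin d → Bool) (i : Fin d) : flipC (flipC x i) i = x := by
  simp [flipC]

lemma flipC_comm {d : ℕ} (x : Fin d → Bool) (i j : Fin d) :
    flipC (flipC x i) j = flipC (flipC x j) i := by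
  rcases eq_or_ne i j with rfl | h
  · rfl
  · simp [flipC, h, h.symm, Function.update_comm h]

/-- The flip of a coordinate, as a permutation of the cube. -/
def flipEquiv {d : ℕ} (i : Fin d) : Equiv.Perm (Fin d → Bool) where
  toFun x := flipC x i
  invFun x := flipC x i
  left_inv x := flipC_flipC x i
  right_inv x := flipC_flipC x i

lemma sum_flipC {d : ℕ} (i : Fin d) (F : (Fin d → Bool) → ℝ) :
    ∑ x, F (flipC x i) = ∑ x, F x :=
  Equiv.sum_comp (flipEquiv i) F

lemma sum_le_sum_of_pairs {d : ℕ} (i : Fin d) {F G : (Fin d → Bool) → ℝ}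
    (h : ∀ x, F x + F (flipC x i) ≤ G x + G (flipC x i)) : ∑ x, F x ≤ ∑ x, G x := by
  have := Finset.sum_le_sum fun x (_ : x ∈ univ) => h x
  rw [sum_add_distrib, sum_add_distrib, sum_flipC, sum_flipC] at this
  linarith

/-- The real value of a truth value. -/
def ind (b : Bool) : ℝ := if b then 1 else 0

lemma ind_nonneg (b : Bool) : 0 ≤ ind b := by cases b <;> simp [ind]

lemma ind_le_one (b : Bool) : ind b ≤ 1 := by cases b <;> simp [ind]

lemma ind_sq (b : Bool) : ind b ^ 2 = ind b := by cases b <;> simp [ind]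

/-- Sort every line in direction `i`. -/
def srt {d : ℕ} (i : Fin d) (u : (Fin d → Bool) → Bool) : (Fin d → Bool) → Bool :=
  fun x => if x i then u x || u (flipC x i) else u x && u (flipC x i)

/-- The edge at `x` in direction `i` is violated by `u`. -/
def viol {d : ℕ} (u : (Fin d → Bool) → Bool) (x : Fin d → Bool) (i : Fin d) : Bool :=
  xor (srt i u x) (u x)

lemma viol_eq {d : ℕ} (u : (Fin d → Bool) → Bool) (x : Fin d → Bool) (i : Fin d) :
    viol u x i = if x i then (!u x && u (flipC x i)) else (u x && !u (flipC x i)) := by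
  unfold viol srt
  cases x i <;> cases u x <;> cases u (flipC x i) <;> rfl

lemma viol_flipC {d : ℕ} (u : (Fin d → Bool) → Bool) (x : Fin d → Bool) (i : Fin d) :
    viol u (flipC x i) i = viol u x i := by
  rw [viol_eq, viol_eq, flipC_flipC, flipC_apply_self]
  cases x i <;> cases u x <;> cases u (flipC x i) <;> rfl

lemma sum_ind_srt {d : ℕ} (i : Fin d) (u : (Fin d → Bool) → Bool) :
    ∑ x, ind (srt i u x) = ∑ x, ind (u x) := by
  apply le_antisymm <;> refine sum_le_sum_of_pairs i fun x => le_of_eq ?_ <;>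
  · simp only [srt, flipC_flipC, flipC_apply_self]
    cases x i <;> cases u x <;> cases u (flipC x i) <;> simp [ind]

lemma sum_mul_le_sum_srt_mul {d : ℕ} (i : Fin d) (u v : (Fin d → Bool) → Bool) :
    ∑ x, ind (u x) * ind (v x) ≤ ∑ x, ind (srt i u x) * ind (srt i v x) := by
  refine sum_le_sum_of_pairs i fun x => ?_
  simp only [srt, flipC_flipC, flipC_apply_self]
  cases x i <;> cases u x <;> cases u (flipC x i) <;> cases v x <;> cases v (flipC x i) <;>
    simp [ind]

/-- The number of points where two Boolean functions differ. -/
def hd {d : ℕ} (u v : (Fin d → Bool) → Bool) : ℝ := ∑ x, ind (xor (u x) (v x))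

lemma hd_eq {d : ℕ} (u v : (Fin d → Bool) → Bool) :
    hd u v = ∑ x, ind (u x) + ∑ x, ind (v x) - 2 * ∑ x, ind (u x) * ind (v x) := by
  rw [hd, mul_sum, ← sum_add_distrib, ← sum_sub_distrib]
  refine sum_congr rfl fun x _ => ?_
  cases u x <;> cases v x <;> norm_num [ind]

lemma hd_triangle {d : ℕ} (u v w : (Fin d → Bool) → Bool) : hd u w ≤ hd u v + hd v w := by
  rw [hd, hd, hd, ← sum_add_distrib]
  refine sum_le_sum fun x _ => ?_
  cases u x <;> cases v x <;> cases w x <;> norm_num [ind]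

lemma hd_comm {d : ℕ} (u v : (Fin d → Bool) → Bool) : hd u v = hd v u := by
  simp only [hd, Bool.xor_comm]

lemma hd_srt_le {d : ℕ} (i : Fin d) (u v : (Fin d → Bool) → Bool) :
    hd (srt i u) (srt i v) ≤ hd u v := by
  rw [hd_eq, hd_eq, sum_ind_srt, sum_ind_srt]
  linarith [sum_mul_le_sum_srt_mul i u v]

lemma srt_srt_self {d : ℕ} (i : Fin d) (u : (Fin d → Bool) → Bool) :
    srt i (srt i u) = srt i u := by
  funext x
  simp only [srt, flipC_flipC, flipC_apply_self]
  cases x i <;> cases u x <;> cases u (flipC x i) <;> rfl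

/-- Sorting along `j` keeps a function sorted along `i`. -/
lemma srt_srt_of_srt_eq {d : ℕ} (i j : Fin d) (u : (Fin d → Bool) → Bool)
    (h : srt i u = u) : srt i (srt j u) = srt j u := by
  rcases eq_or_ne i j with rfl | hij
  · exact srt_srt_self i u
  funext x
  have h1 := congrFun h x
  have h2 := congrFun h (flipC x j)
  simp only [srt, flipC_apply_ne _ hij, flipC_apply_ne _ hij.symm, flipC_comm x j i] at h1 h2 ⊢
  revert h1 h2
  cases x i <;> cases x j <;> cases u x <;> cases u (flipC x i) <;> cases u (flipC x j) <;>
    cases u (flipC (flipC x i) j) <;> simp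

/-- Sort successively along the coordinates of a list. -/
def run {d : ℕ} (l : List (Fin d)) (u : (Fin d → Bool) → Bool) : (Fin d → Bool) → Bool :=
  l.foldl (fun v i => srt i v) u

lemma run_nil {d : ℕ} (u : (Fin d → Bool) → Bool) : run [] u = u := rfl

lemma run_cons {d : ℕ} (i : Fin d) (l : List (Fin d)) (u : (Fin d → Bool) → Bool) :
    run (i :: l) u = run l (srt i u) := rfl

lemma run_append {d : ℕ} (l l' : List (Fin d)) (u : (Fin d → Bool) → Bool) :
    run (l ++ l') u = run l' (run l u) := by
  simp [run]

lemma sum_ind_run {d : ℕ} (l : List (Fin d)) (u : (Fin d → Bool) → Bool) :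
    ∑ x, ind (run l u x) = ∑ x, ind (u x) := by
  induction l generalizing u with
  | nil => rfl
  | cons i l ih => rw [run_cons, ih, sum_ind_srt]

lemma hd_run_le {d : ℕ} (l : List (Fin d)) (u v : (Fin d → Bool) → Bool) :
    hd (run l u) (run l v) ≤ hd u v := by
  induction l generalizing u v with
  | nil => exact le_rfl
  | cons i l ih => exact (ih _ _).trans (hd_srt_le i u v)

lemma srt_run_of_srt_eq {d : ℕ} (i : Fin d) (l : List (Fin d)) (u : (Fin d → Bool) → Bool)
    (h : srt i u = u) : srt i (run l u) = run l u := by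
  induction l generalizing u with
  | nil => exact h
  | cons j l ih => exact ih _ (srt_srt_of_srt_eq i j u h)

lemma srt_run_of_mem {d : ℕ} (i : Fin d) (l : List (Fin d)) (u : (Fin d → Bool) → Bool)
    (h : i ∈ l) : srt i (run l u) = run l u := by
  induction l generalizing u with
  | nil => simp at h
  | cons j l ih =>
    rcases List.mem_cons.1 h with rfl | h
    · exact srt_run_of_srt_eq i l _ (srt_srt_self i u)
    · exact ih _ h

lemma run_eq_self {d : ℕ} (l : List (Fin d)) (u : (Fin d → Bool) → Bool)
    (h : ∀ i ∈ l, srt i u = u) : run l u = u := by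
  induction l with
  | nil => rfl
  | cons i l ih =>
    rw [run_cons, h i (by simp)]
    exact ih fun j hj => h j (by simp [hj])

lemma run_run_self {d : ℕ} (l : List (Fin d)) (u : (Fin d → Bool) → Bool) :
    run l (run l u) = run l u :=
  run_eq_self l _ fun i hi => srt_run_of_mem i l u hi

/-- Sorting along `i` before the coordinates of `l` moves the values at least as far as
sorting along `i` afterwards. -/
lemma run_srt_le {d : ℕ} (i : Fin d) (l : List (Fin d)) (u : (Fin d → Bool) → Bool) :
    ∀ x : Fin d → Bool, (x i = false → run l (srt i u) x ≤ srt i (run l u) x) ∧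
      (x i = true → srt i (run l u) x ≤ run l (srt i u) x) := by
  induction l using List.reverseRecOn with
  | nil => exact fun x => ⟨fun _ => le_rfl, fun _ => le_rfl⟩
  | append_singleton l j ih =>
    intro x
    simp only [run_append, run_cons, run_nil]
    generalize run l (srt i u) = A at *
    generalize run l u = B at *
    rcases eq_or_ne i j with rfl | hij
    · have h1 := ih x
      have h2 := ih (flipC x i)
      simp only [srt, flipC_flipC, flipC_apply_self] at h1 h2 ⊢
      revert h1 h2
      generalize A x = a1, A (flipC x i) = a2, B x = b1, B (flipC x i) = b2, x i = c
      revert a1 a2 b1 b2 c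
      decide
    · have h1 := ih x
      have h2 := ih (flipC x j)
      simp only [srt, flipC_apply_ne _ hij, flipC_apply_ne _ hij.symm, flipC_comm x j i] at h1 h2 ⊢
      revert h1 h2
      generalize A x = a1, A (flipC x j) = a2, B x = b1, B (flipC x j) = b2, x i = c, x j = e,
        B (flipC x i) = b3, B (flipC (flipC x i) j) = b4
      revert a1 a2 b1 b2 b3 b4 c e
      decide

/-! ### Averages over lazy random words -/

/-- The average over the words obtained in `n` steps, each of which appends a uniformly random
coordinate with probability `1/2` and does nothing otherwise. -/
noncomputable def wordAvg (d : ℕ) : ℕ → (List (Fin d) → ℝ) →ₗ[ℝ] ℝ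
  | 0 => LinearMap.proj []
  | n + 1 => (1 / (2 * d : ℝ)) • ∑ i : Fin d,
      ((wordAvg d n).comp (LinearMap.funLeft ℝ ℝ (List.cons i)) + wordAvg d n)

lemma wordAvg_zero {d : ℕ} (F : List (Fin d) → ℝ) : wordAvg d 0 F = F [] := rfl

lemma wordAvg_succ {d : ℕ} (n : ℕ) (F : List (Fin d) → ℝ) :
    wordAvg d (n + 1) F = 1 / (2 * d : ℝ) *
      ∑ i : Fin d, (wordAvg d n (fun l => F (i :: l)) + wordAvg d n F) := by
  simp only [wordAvg, LinearMap.smul_apply, LinearMap.sum_apply, LinearMap.add_apply,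
    LinearMap.comp_apply, smul_eq_mul]
  rfl

lemma wordAvg_mono {d : ℕ} (n : ℕ) {F G : List (Fin d) → ℝ} (h : ∀ l, F l ≤ G l) :
    wordAvg d n F ≤ wordAvg d n G := by
  induction n generalizing F G with
  | zero => exact h _
  | succ n ih =>
    rw [wordAvg_succ, wordAvg_succ]
    gcongr with i
    · exact ih fun l => h _
    · exact ih h

lemma wordAvg_const {d : ℕ} (hd : 0 < d) (n : ℕ) (c : ℝ) :
    wordAvg d n (fun _ => c) = c := by
  induction n with
  | zero => rfl
  | succ n ih =>
    have : (d : ℝ) ≠ 0 := by positivity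
    rw [wordAvg_succ, ih, sum_const, card_univ, Fintype.card_fin, nsmul_eq_mul]
    field_simp
    ring

lemma wordAvg_nonneg {d : ℕ} (n : ℕ) {F : List (Fin d) → ℝ} (h : ∀ l, 0 ≤ F l) :
    0 ≤ wordAvg d n F := by
  have := wordAvg_mono n (F := 0) h
  rwa [map_zero] at this

lemma wordAvg_sum {d : ℕ} {ι : Type*} (n : ℕ) (s : Finset ι) (F : ι → List (Fin d) → ℝ) :
    wordAvg d n (fun l => ∑ a ∈ s, F a l) = ∑ a ∈ s, wordAvg d n (F a) := by
  rw [← map_sum]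
  congr 1
  funext l
  simp

lemma wordAvg_add {d : ℕ} (n : ℕ) (F G : List (Fin d) → ℝ) :
    wordAvg d n (fun l => F l + G l) = wordAvg d n F + wordAvg d n G :=
  map_add (wordAvg d n) F G

lemma wordAvg_sub {d : ℕ} (n : ℕ) (F G : List (Fin d) → ℝ) :
    wordAvg d n (fun l => F l - G l) = wordAvg d n F - wordAvg d n G :=
  map_sub (wordAvg d n) F G

lemma wordAvg_mul {d : ℕ} (n : ℕ) (c : ℝ) (F : List (Fin d) → ℝ) :
    wordAvg d n (fun l => c * F l) = c * wordAvg d n F :=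
  map_smul (wordAvg d n) c F

lemma wordAvg_add_steps {d : ℕ} (n m : ℕ) (F : List (Fin d) → ℝ) :
    wordAvg d (n + m) F = wordAvg d n (fun l => wordAvg d m (fun l' => F (l ++ l'))) := by
  induction n generalizing F with
  | zero => simp [wordAvg_zero]
  | succ n ih =>
    rw [show n + 1 + m = n + m + 1 by ring, wordAvg_succ, wordAvg_succ]
    simp only [ih, List.cons_append]

lemma wordAvg_one {d : ℕ} (F : List (Fin d) → ℝ) :
    wordAvg d 1 F = 1 / (2 * d : ℝ) * ∑ i : Fin d, (F [i] + F []) := by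
  rw [wordAvg_succ]
  simp only [wordAvg_zero]

lemma sq_wordAvg_le {d : ℕ} (hd : 0 < d) (n : ℕ) (F : List (Fin d) → ℝ) :
    (wordAvg d n F) ^ 2 ≤ wordAvg d n (fun l => F l ^ 2) := by
  set c := wordAvg d n F with hc
  have h : 0 ≤ wordAvg d n (fun l => (F l ^ 2 - 2 * c * F l) + c ^ 2) :=
    wordAvg_nonneg n fun l => by nlinarith [sq_nonneg (F l - c)]
  rw [wordAvg_add, wordAvg_sub, wordAvg_mul, wordAvg_const hd, ← hc] at h
  linarith

lemma sqrt_sum_sq_wordAvg_le {d : ℕ} {ι : Type*} (s : Finset ι) (n : ℕ)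
    (F : ι → List (Fin d) → ℝ) :
    Real.sqrt (∑ a ∈ s, wordAvg d n (F a) ^ 2) ≤
      wordAvg d n (fun l => Real.sqrt (∑ a ∈ s, F a l ^ 2)) := by
  set A := Real.sqrt (∑ a ∈ s, wordAvg d n (F a) ^ 2) with hA
  have hA2 : A ^ 2 = ∑ a ∈ s, wordAvg d n (F a) ^ 2 :=
    Real.sq_sqrt (sum_nonneg fun _ _ => sq_nonneg _)
  have h0 : 0 ≤ wordAvg d n (fun l => Real.sqrt (∑ a ∈ s, F a l ^ 2)) :=
    wordAvg_nonneg n fun _ => Real.sqrt_nonneg _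
  have h : A ^ 2 ≤ A * wordAvg d n (fun l => Real.sqrt (∑ a ∈ s, F a l ^ 2)) := by
    calc A ^ 2 = wordAvg d n (fun l => ∑ a ∈ s, wordAvg d n (F a) * F a l) := by
          rw [hA2, wordAvg_sum]
          exact sum_congr rfl fun a _ => by rw [wordAvg_mul, sq]
      _ ≤ wordAvg d n (fun l => A * Real.sqrt (∑ a ∈ s, F a l ^ 2)) :=
          wordAvg_mono n fun l => Real.sum_mul_le_sqrt_mul_sqrt s _ _
      _ = _ := wordAvg_mul _ _ _
  rcases (Real.sqrt_nonneg _ : 0 ≤ A).eq_or_lt with h' | h'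
  · rw [hA, ← h']
    exact h0
  · nlinarith

/-! ### The variance of the value at a point -/

/-- The probability that the edge at `x` in direction `i` is violated after `n` steps. -/
noncomputable def violProb {d : ℕ} (n : ℕ) (u : (Fin d → Bool) → Bool) (x : Fin d → Bool)
    (i : Fin d) : ℝ :=
  wordAvg d n (fun l => ind (viol (run l u) x i))

/-- The mean value at `x` after `n` steps. -/
noncomputable def meanVal {d : ℕ} (n : ℕ) (u : (Fin d → Bool) → Bool) (x : Fin d → Bool) : ℝ :=
  wordAvg d n (fun l => ind (run l u x))

lemma violProb_nonneg {d : ℕ} (n : ℕ) (u : (Fin d → Bool) → Bool) (x : Fin d → Bool)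
    (i : Fin d) : 0 ≤ violProb n u x i :=
  wordAvg_nonneg n fun _ => ind_nonneg _

lemma violProb_succ {d : ℕ} (n : ℕ) (u : (Fin d → Bool) → Bool) (x : Fin d → Bool)
    (i : Fin d) : violProb (n + 1) u x i =
      wordAvg d 1 (fun l => violProb n (run l u) x i) := by
  rw [violProb, Nat.add_comm, wordAvg_add_steps]
  simp only [run_append, violProb]

lemma meanVal_succ {d : ℕ} (n : ℕ) (u : (Fin d → Bool) → Bool) (x : Fin d → Bool) :
    meanVal (n + 1) u x = wordAvg d 1 (fun l => meanVal n (run l u) x) := by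
  rw [meanVal, Nat.add_comm, wordAvg_add_steps]
  simp only [run_append, meanVal]

lemma sq_violProb_le {d : ℕ} (n : ℕ) (u : (Fin d → Bool) → Bool) (x : Fin d → Bool)
    (i : Fin d) : violProb n u x i ^ 2 ≤ (meanVal n (srt i u) x - meanVal n u x) ^ 2 := by
  rw [meanVal, meanVal, ← wordAvg_sub]
  cases hx : x i
  · have : violProb n u x i ≤
        wordAvg d n (fun l => -1 * (ind (run l (srt i u) x) - ind (run l u x))) := by
      refine wordAvg_mono n fun l => ?_
      have := (run_srt_le i l u x).1 hx
      have h2 : srt i (run l u) x = (run l u x && run l u (flipC x i)) := by simp [srt, hx]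
      rw [viol]
      rw [h2] at this ⊢
      revert this
      generalize run l (srt i u) x = a, run l u x = b, run l u (flipC x i) = c
      cases a <;> cases b <;> cases c <;> simp [ind]
    rw [wordAvg_mul] at this
    nlinarith [violProb_nonneg n u x i]
  · have : violProb n u x i ≤ wordAvg d n (fun l => ind (run l (srt i u) x) - ind (run l u x)) := by
      refine wordAvg_mono n fun l => ?_
      have := (run_srt_le i l u x).2 hx
      have h2 : srt i (run l u) x = (run l u x || run l u (flipC x i)) := by simp [srt, hx]
      rw [viol]
      rw [h2] at this ⊢
      revert this
      generalize run l (srt i u) x = a, run l u x = b, run l u (flipC x i) = c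
      cases a <;> cases b <;> cases c <;> simp [ind]
    exact pow_le_pow_left₀ (violProb_nonneg n u x i) this 2

lemma variance_step {d : ℕ} (hd : 0 < d) (n : ℕ) (u : (Fin d → Bool) → Bool)
    (x : Fin d → Bool) :
    1 / (4 * d : ℝ) * ∑ i, violProb n u x i ^ 2 ≤
      wordAvg d 1 (fun l => meanVal n (run l u) x ^ 2) - meanVal (n + 1) u x ^ 2 := by
  rw [meanVal_succ, wordAvg_one, wordAvg_one]
  simp only [run_nil, run_cons]
  have h1 : ∑ i, violProb n u x i ^ 2 ≤ ∑ i, (meanVal n (srt i u) x - meanVal n u x) ^ 2 :=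
    sum_le_sum fun i _ => sq_violProb_le n u x i
  have h2 := sq_sum_le_card_mul_sum_sq (s := univ)
    (f := fun i : Fin d => meanVal n (srt i u) x + meanVal n u x)
  rw [card_univ, Fintype.card_fin] at h2
  have h3 : ∑ i : Fin d, (meanVal n (srt i u) x + meanVal n u x) ^ 2
      + ∑ i : Fin d, (meanVal n (srt i u) x - meanVal n u x) ^ 2
      = 2 * ∑ i : Fin d, (meanVal n (srt i u) x ^ 2 + meanVal n u x ^ 2) := by
    rw [← sum_add_distrib, mul_sum]
    exact sum_congr rfl fun i _ => by ring
  have hd' : (0 : ℝ) < d := by exact_mod_cast hd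
  set a := ∑ i, violProb n u x i ^ 2
  set b := ∑ i : Fin d, (meanVal n (srt i u) x - meanVal n u x) ^ 2
  set c := ∑ i : Fin d, (meanVal n (srt i u) x + meanVal n u x) ^ 2
  set e := ∑ i : Fin d, (meanVal n (srt i u) x + meanVal n u x)
  set g := ∑ i : Fin d, (meanVal n (srt i u) x ^ 2 + meanVal n u x ^ 2)
  have h4 : 1 / (2 * d : ℝ) * g - (1 / (2 * d : ℝ) * e) ^ 2 - 1 / (4 * d : ℝ) * a =
      (d * (b - a) + (d * c - e ^ 2)) / (4 * d ^ 2) := by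
    have : g = (c + b) / 2 := by linarith
    rw [this]
    field_simp
    ring
  have h5 : 0 ≤ (d * (b - a) + (d * c - e ^ 2)) / (4 * (d : ℝ) ^ 2) := by
    apply div_nonneg _ (by positivity)
    nlinarith
  linarith

lemma sum_sq_violProb_le_variance {d : ℕ} (hd : 0 < d) (n : ℕ) (u : (Fin d → Bool) → Bool)
    (x : Fin d → Bool) :
    (n + 1) / (4 * d : ℝ) * ∑ i, violProb n u x i ^ 2 ≤
      wordAvg d (n + 1) (fun l => ind (run l u x) ^ 2) - meanVal (n + 1) u x ^ 2 := by
  have step : ∀ (m : ℕ) (v : (Fin d → Bool) → Bool),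
      wordAvg d (m + 1) (fun l => ind (run l v x) ^ 2) - meanVal (m + 1) v x ^ 2 =
      wordAvg d 1 (fun l => wordAvg d m (fun l' => ind (run l' (run l v) x) ^ 2)
          - meanVal m (run l v) x ^ 2)
        + (wordAvg d 1 (fun l => meanVal m (run l v) x ^ 2) - meanVal (m + 1) v x ^ 2) := by
    intro m v
    rw [wordAvg_sub, Nat.add_comm m 1, wordAvg_add_steps]
    simp only [run_append]
    ring
  induction n generalizing u with
  | zero =>
    rw [step]
    have := variance_step hd 0 u x
    have h0 : wordAvg d 1 (fun l => wordAvg d 0 (fun l' => ind (run l' (run l u) x) ^ 2)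
          - meanVal 0 (run l u) x ^ 2) = 0 := by
      simp [wordAvg_zero, meanVal, wordAvg_const hd]
    rw [h0]
    simpa using this
  | succ n ih =>
    rw [step]
    have h1 := variance_step hd (n + 1) u x
    have h2 : (n + 1) / (4 * d : ℝ) * ∑ i, violProb (n + 1) u x i ^ 2 ≤
        wordAvg d 1 (fun l => wordAvg d (n + 1) (fun l' => ind (run l' (run l u) x) ^ 2)
          - meanVal (n + 1) (run l u) x ^ 2) := by
      refine le_trans ?_ (wordAvg_mono 1 fun l => ih (run l u))
      rw [wordAvg_mul, wordAvg_sum]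
      gcongr with i
      rw [violProb_succ]
      exact sq_wordAvg_le hd 1 _
    push_cast
    calc _ = (n + 1) / (4 * d : ℝ) * ∑ i, violProb (n + 1) u x i ^ 2
          + 1 / (4 * d : ℝ) * ∑ i, violProb (n + 1) u x i ^ 2 := by ring
      _ ≤ _ := add_le_add h2 h1

lemma sum_sq_violProb_le {d : ℕ} (hd : 0 < d) (n : ℕ) (u : (Fin d → Bool) → Bool)
    (x : Fin d → Bool) : ∑ i, violProb n u x i ^ 2 ≤ 4 * d / (n + 1) := by
  have h := sum_sq_violProb_le_variance hd n u x
  have h1 : wordAvg d (n + 1) (fun l => ind (run l u x) ^ 2) ≤ 1 := by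
    refine (wordAvg_mono _ fun l => ?_).trans (wordAvg_const hd (n + 1) 1).le
    rw [ind_sq]
    exact ind_le_one _
  have hd' : (0 : ℝ) < d := by exact_mod_cast hd
  rw [le_div_iff₀ (by positivity)]
  have h2 : (n + 1) / (4 * d : ℝ) * ∑ i, violProb n u x i ^ 2 ≤ 1 := by
    nlinarith [sq_nonneg (meanVal (n + 1) u x)]
  have h3 : (n + 1) / (4 * d : ℝ) * ∑ i, violProb n u x i ^ 2
      = (∑ i, violProb n u x i ^ 2) * (n + 1) / (4 * d) := by ring
  rw [h3, div_le_one (by positivity)] at h2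
  exact h2

/-! ### Markings of the violated edges -/

/-- A marking assigns to each point some of the directions of the violated edges at that point,
so that every violated edge is assigned to at least one of its endpoints. -/
def IsMarking {d : ℕ} (u : (Fin d → Bool) → Bool) (m : (Fin d → Bool) → Finset (Fin d)) : Prop :=
  ∀ x i, (i ∈ m x → viol u x i = true) ∧ (viol u x i = true → i ∈ m x ∨ i ∈ m (flipC x i))

/-- The cost of a marking. -/
noncomputable def cost {d : ℕ} (m : (Fin d → Bool) → Finset (Fin d)) : ℝ :=
  ∑ x, Real.sqrt (#(m x))

lemma exists_optimal_marking {d : ℕ} (u : (Fin d → Bool) → Bool) :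
    ∃ m, IsMarking u m ∧ ∀ m', IsMarking u m' → cost m ≤ cost m' := by
  have hne : ({m | IsMarking u m} : Set ((Fin d → Bool) → Finset (Fin d))).Nonempty :=
    ⟨fun x => {i | viol u x i = true}, fun x i => ⟨by simp, fun h => Or.inl (by simpa using h)⟩⟩
  obtain ⟨m, hm, h⟩ := Set.exists_min_image _ cost (Set.toFinite _) hne
  exact ⟨m, hm, h⟩

/-- A marking of least cost. -/
noncomputable def optMarking {d : ℕ} (u : (Fin d → Bool) → Bool) :
    (Fin d → Bool) → Finset (Fin d) :=
  (exists_optimal_marking u).choose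

/-- The least cost of a marking. -/
noncomputable def tal {d : ℕ} (u : (Fin d → Bool) → Bool) : ℝ := cost (optMarking u)

lemma isMarking_optMarking {d : ℕ} (u : (Fin d → Bool) → Bool) : IsMarking u (optMarking u) :=
  (exists_optimal_marking u).choose_spec.1

lemma tal_le_cost {d : ℕ} {u : (Fin d → Bool) → Bool} {m : (Fin d → Bool) → Finset (Fin d)}
    (h : IsMarking u m) : tal u ≤ cost m :=
  (exists_optimal_marking u).choose_spec.2 m h

lemma tal_nonneg {d : ℕ} (u : (Fin d → Bool) → Bool) : 0 ≤ tal u :=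
  sum_nonneg fun _ _ => Real.sqrt_nonneg _

lemma sqrt_inter_add_sqrt_union_le {α : Type*} [DecidableEq α] (a b : Finset α) :
    Real.sqrt #(a ∩ b) + Real.sqrt #(a ∪ b) ≤ Real.sqrt #a + Real.sqrt #b := by
  have h1 : (#(a ∪ b) : ℝ) + #(a ∩ b) = #a + #b := by exact_mod_cast card_union_add_card_inter a b
  have h2 : (#(a ∩ b) : ℝ) ≤ #a := by exact_mod_cast card_le_card inter_subset_left
  have h3 : (#(a ∩ b) : ℝ) ≤ #b := by exact_mod_cast card_le_card inter_subset_right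
  refine abs_le_of_sq_le_sq' ?_ (by positivity) |>.2
  have h4 : Real.sqrt #(a ∩ b) * Real.sqrt #(a ∪ b) ≤ Real.sqrt #a * Real.sqrt #b := by
    rw [← Real.sqrt_mul (by positivity), ← Real.sqrt_mul (by positivity)]
    apply Real.sqrt_le_sqrt
    nlinarith
  rw [add_sq, add_sq, Real.sq_sqrt (by positivity), Real.sq_sqrt (by positivity),
    Real.sq_sqrt (by positivity), Real.sq_sqrt (by positivity)]
  nlinarith

/-- The marking obtained by sorting along `j`. -/
def sortMarking {d : ℕ} (j : Fin d) (u : (Fin d → Bool) → Bool)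
    (m : (Fin d → Bool) → Finset (Fin d)) (x : Fin d → Bool) : Finset (Fin d) :=
  if u x = u (flipC x j) then
    if u x = x j then (m x).erase j ∩ (m (flipC x j)).erase j
    else (m x).erase j ∪ (m (flipC x j)).erase j
  else if u x = x j then {i ∈ (m x).erase j | viol (srt j u) x i = true}
  else {i ∈ (m (flipC x j)).erase j | viol (srt j u) x i = true}

lemma cost_sortMarking_le {d : ℕ} (j : Fin d) (u : (Fin d → Bool) → Bool)
    (m : (Fin d → Bool) → Finset (Fin d)) :
    cost (sortMarking j u m) ≤ ∑ x, Real.sqrt #((m x).erase j) := by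
  refine sum_le_sum_of_pairs j fun x => ?_
  have key := sqrt_inter_add_sqrt_union_le ((m x).erase j) ((m (flipC x j)).erase j)
  have hf : ∀ (a : Finset (Fin d)) (p : Fin d → Prop) [DecidablePred p],
      Real.sqrt #(a.filter p) ≤ Real.sqrt #a := fun a p _ =>
    Real.sqrt_le_sqrt (by exact_mod_cast card_filter_le a p)
  have h1 := hf ((m x).erase j) (fun i => viol (srt j u) x i = true)
  have h2 := hf ((m (flipC x j)).erase j) (fun i => viol (srt j u) x i = true)
  have h3 := hf ((m x).erase j) (fun i => viol (srt j u) (flipC x j) i = true)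
  have h4 := hf ((m (flipC x j)).erase j) (fun i => viol (srt j u) (flipC x j) i = true)
  unfold sortMarking
  rw [flipC_flipC, flipC_apply_self]
  generalize (m x).erase j = a, (m (flipC x j)).erase j = b at *
  cases u x <;> cases u (flipC x j) <;> cases x j <;>
    simp [inter_comm b a, union_comm b a] <;> linarith

lemma isMarking_sortMarking {d : ℕ} (j : Fin d) {u : (Fin d → Bool) → Bool}
    {m : (Fin d → Bool) → Finset (Fin d)} (h : IsMarking u m) :
    IsMarking (srt j u) (sortMarking j u m) := by
  intro x i
  rcases eq_or_ne i j with rfl | hij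
  · have h0 : viol (srt i u) x i = false := by rw [viol, srt_srt_self, Bool.xor_self]
    rw [h0]
    unfold sortMarking
    split_ifs <;> simp
  have h1 := h x i
  have h2 := h (flipC x j) i
  have h3 := (h (flipC x i) i).1
  have h4 := (h (flipC (flipC x j) i) i).1
  simp only [sortMarking, apply_ite (fun s : Finset (Fin d) => i ∈ s), mem_inter, mem_union,
    mem_filter, mem_erase, ne_eq, hij, not_false_eq_true, true_and]
  simp only [viol_eq, srt, flipC_flipC, flipC_apply_self, flipC_apply_ne _ hij,
    flipC_apply_ne _ hij.symm, flipC_comm x i j] at h1 h2 h3 h4 ⊢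
  obtain ⟨M, hM⟩ : ∃ M : (Fin d → Bool) → Bool, ∀ y, i ∈ m y ↔ M y = true :=
    ⟨fun y => decide (i ∈ m y), by simp⟩
  simp only [hM] at h1 h2 h3 h4 ⊢
  revert h1 h2 h3 h4
  generalize u x = a1, u (flipC x j) = a2, u (flipC x i) = a3, u (flipC (flipC x j) i) = a4,
    M x = m1, M (flipC x j) = m2, M (flipC x i) = m3, M (flipC (flipC x j) i) = m4
  cases x i <;> cases x j <;> cases a1 <;> cases a2 <;> cases a3 <;> cases a4 <;>
    simp <;> (try grind)

lemma sum_sqrt_card_erase_le {d : ℕ} (s : Finset (Fin d)) :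
    ∑ j, Real.sqrt #(s.erase j) ≤ (d - 1 / 2) * Real.sqrt #s := by
  have hle : ∀ j, Real.sqrt #(s.erase j) =
      Real.sqrt #s - if j ∈ s then Real.sqrt #s - Real.sqrt (#s - 1) else 0 := by
    intro j
    split_ifs with h
    · rw [card_erase_of_mem h, Nat.cast_pred (card_pos.2 ⟨j, h⟩)]
      ring
    · rw [erase_eq_of_notMem h, sub_zero]
  simp only [hle]
  rw [sum_sub_distrib, sum_const, card_univ, Fintype.card_fin, sum_ite_mem, univ_inter, sum_const,
    nsmul_eq_mul, nsmul_eq_mul]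
  rcases s.eq_empty_or_nonempty with rfl | hs
  · simp
  have h1 : (1 : ℝ) ≤ #s := by exact_mod_cast hs.card_pos
  generalize (#s : ℝ) = k at *
  have h2 : Real.sqrt k * Real.sqrt k = k := Real.mul_self_sqrt (by linarith)
  have h3 : Real.sqrt (k - 1) * Real.sqrt (k - 1) = k - 1 := Real.mul_self_sqrt (by linarith)
  have h4 : 0 < Real.sqrt k := Real.sqrt_pos.2 (by linarith)
  have h5 := Real.sqrt_nonneg (k - 1)
  generalize Real.sqrt k = a at *
  generalize Real.sqrt (k - 1) = b at *
  nlinarith [mul_nonneg h4.le (sq_nonneg (a - b))]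

lemma sum_tal_srt_le {d : ℕ} (u : (Fin d → Bool) → Bool) :
    ∑ j, tal (srt j u) ≤ (d - 1 / 2) * tal u := by
  calc ∑ j, tal (srt j u) ≤ ∑ j, ∑ x, Real.sqrt #((optMarking u x).erase j) :=
        sum_le_sum fun j _ => (tal_le_cost (isMarking_sortMarking j (isMarking_optMarking u))).trans
          (cost_sortMarking_le j u _)
    _ ≤ ∑ x, (d - 1 / 2) * Real.sqrt #(optMarking u x) := by
        rw [sum_comm]
        exact sum_le_sum fun x _ => sum_sqrt_card_erase_le _
    _ = _ := by rw [← mul_sum]; rfl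

lemma wordAvg_tal_le {d : ℕ} (hd : 0 < d) (n : ℕ) (u : (Fin d → Bool) → Bool) :
    wordAvg d n (fun l => tal (run l u)) ≤ (1 - 1 / (4 * d : ℝ)) ^ n * tal u := by
  have h1 : (1 : ℝ) ≤ d := by exact_mod_cast hd
  have h0 : (0 : ℝ) ≤ 1 - 1 / (4 * d : ℝ) := by
    rw [sub_nonneg, div_le_one (by positivity)]
    linarith
  induction n generalizing u with
  | zero => simp [wordAvg_zero, run_nil]
  | succ n ih =>
    rw [wordAvg_succ]
    calc 1 / (2 * d : ℝ) * ∑ i : Fin d, (wordAvg d n (fun l => tal (run (i :: l) u))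
          + wordAvg d n (fun l => tal (run l u)))
        ≤ 1 / (2 * d : ℝ) * ∑ i : Fin d, ((1 - 1 / (4 * d : ℝ)) ^ n * tal (srt i u)
          + (1 - 1 / (4 * d : ℝ)) ^ n * tal u) := by
          gcongr with i
          · exact ih (srt i u)
          · exact ih u
      _ = (1 - 1 / (4 * d : ℝ)) ^ n * (1 / (2 * d : ℝ) * (∑ i : Fin d, tal (srt i u) + d * tal u)) := by
          rw [sum_add_distrib, ← mul_sum, sum_const, card_univ, Fintype.card_fin, nsmul_eq_mul]
          ring
      _ ≤ (1 - 1 / (4 * d : ℝ)) ^ n *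
            (1 / (2 * d : ℝ) * ((d - 1 / 2) * tal u + d * tal u)) := by
          gcongr
          exact sum_tal_srt_le u
      _ = _ := by
          rw [pow_succ]
          field_simp
          ring

lemma wordAvg_tal_le_tal {d : ℕ} (hd : 0 < d) (n : ℕ) (u : (Fin d → Bool) → Bool) :
    wordAvg d n (fun l => tal (run l u)) ≤ tal u := by
  have h1 : (1 : ℝ) ≤ d := by exact_mod_cast hd
  refine (wordAvg_tal_le hd n u).trans (mul_le_of_le_one_left (tal_nonneg u) ?_)
  apply pow_le_one₀
  · rw [sub_nonneg, div_le_one (by positivity)]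
    linarith
  · simp

/-! ### The drift of the mean value -/

/-- The mean change of the value at `x` when sorting along `i` after `n` steps. -/
noncomputable def drift {d : ℕ} (n : ℕ) (u : (Fin d → Bool) → Bool) (x : Fin d → Bool)
    (i : Fin d) : ℝ :=
  wordAvg d n (fun l => ind (srt i (run l u) x) - ind (run l u x))

lemma sq_drift_le {d : ℕ} (n : ℕ) (u : (Fin d → Bool) → Bool) (x : Fin d → Bool) (i : Fin d) :
    drift n u x i ^ 2 ≤ violProb n u x i ^ 2 := by
  rw [sq_le_sq, abs_of_nonneg (violProb_nonneg n u x i), abs_le]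
  constructor
  · rw [neg_eq_neg_one_mul, violProb, ← wordAvg_mul]
    refine wordAvg_mono n fun l => ?_
    rw [viol]
    cases srt i (run l u) x <;> cases run l u x <;> simp [ind]
  · refine wordAvg_mono n fun l => ?_
    rw [viol]
    cases srt i (run l u) x <;> cases run l u x <;> simp [ind]

/-- The probability that the edge at `x` in direction `i` is marked at `x` after `n` steps. -/
noncomputable def markProb {d : ℕ} (n : ℕ) (u : (Fin d → Bool) → Bool) (x : Fin d → Bool)
    (i : Fin d) : ℝ :=
  wordAvg d n (fun l => ind (decide (i ∈ optMarking (run l u) x)))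

lemma markProb_nonneg {d : ℕ} (n : ℕ) (u : (Fin d → Bool) → Bool) (x : Fin d → Bool)
    (i : Fin d) : 0 ≤ markProb n u x i :=
  wordAvg_nonneg n fun _ => ind_nonneg _

lemma markProb_le_violProb {d : ℕ} (n : ℕ) (u : (Fin d → Bool) → Bool) (x : Fin d → Bool)
    (i : Fin d) : markProb n u x i ≤ violProb n u x i := by
  refine wordAvg_mono n fun l => ?_
  by_cases h : i ∈ optMarking (run l u) x
  · rw [(isMarking_optMarking (run l u) x i).1 h]
    simp [h]
  · simp only [h, decide_false]
    exact ind_nonneg _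

lemma violProb_le_markProb_add {d : ℕ} (n : ℕ) (u : (Fin d → Bool) → Bool) (x : Fin d → Bool)
    (i : Fin d) : violProb n u x i ≤ markProb n u x i + markProb n u (flipC x i) i := by
  rw [markProb, markProb, ← wordAvg_add]
  refine wordAvg_mono n fun l => ?_
  cases h : viol (run l u) x i
  · exact add_nonneg (ind_nonneg _) (ind_nonneg _)
  · rcases (isMarking_optMarking (run l u) x i).2 h with h1 | h1
    · simp only [h1, decide_true]
      exact le_add_of_nonneg_right (ind_nonneg _)
    · simp only [h1, decide_true]
      exact le_add_of_nonneg_left (ind_nonneg _)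

lemma sum_sq_markProb_le {d : ℕ} (hd : 0 < d) (n : ℕ) (u : (Fin d → Bool) → Bool)
    (x : Fin d → Bool) :
    ∑ i, markProb n u x i ^ 2 ≤ Real.sqrt (4 * d / (n + 1)) *
      wordAvg d n (fun l => Real.sqrt #(optMarking (run l u) x)) := by
  have h1 : ∑ i, markProb n u x i ^ 2 ≤ 4 * d / (n + 1) :=
    (sum_le_sum fun i _ => pow_le_pow_left₀ (markProb_nonneg n u x i)
      (markProb_le_violProb n u x i) 2).trans (sum_sq_violProb_le hd n u x)
  have h2 := sqrt_sum_sq_wordAvg_le (univ : Finset (Fin d)) n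
    (fun i l => ind (decide (i ∈ optMarking (run l u) x)))
  have h3 : ∀ l, ∑ i, ind (decide (i ∈ optMarking (run l u) x)) ^ 2
      = #(optMarking (run l u) x) := by
    intro l
    simp [ind]
  simp only [h3] at h2
  have h0 : 0 ≤ ∑ i, markProb n u x i ^ 2 := sum_nonneg fun _ _ => sq_nonneg _
  calc ∑ i, markProb n u x i ^ 2
      = Real.sqrt (∑ i, markProb n u x i ^ 2) * Real.sqrt (∑ i, markProb n u x i ^ 2) :=
        (Real.mul_self_sqrt h0).symm
    _ ≤ _ := mul_le_mul (Real.sqrt_le_sqrt h1) h2 (Real.sqrt_nonneg _) (Real.sqrt_nonneg _)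

lemma sum_sq_drift_le {d : ℕ} (hd : 0 < d) (n : ℕ) (u : (Fin d → Bool) → Bool) :
    ∑ i, ∑ x, drift n u x i ^ 2 ≤ 8 * Real.sqrt (d / (n + 1)) * tal u := by
  have h1 : ∑ i, ∑ x, drift n u x i ^ 2 ≤ 4 * ∑ x, ∑ i, markProb n u x i ^ 2 := by
    rw [sum_comm (f := fun x i => markProb n u x i ^ 2), mul_sum]
    refine sum_le_sum fun i _ => ?_
    have h2 : ∀ x, drift n u x i ^ 2 ≤
        2 * markProb n u x i ^ 2 + 2 * markProb n u (flipC x i) i ^ 2 := by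
      intro x
      have := pow_le_pow_left₀ (violProb_nonneg n u x i) (violProb_le_markProb_add n u x i) 2
      nlinarith [sq_drift_le n u x i, sq_nonneg (markProb n u x i - markProb n u (flipC x i) i)]
    refine (sum_le_sum fun x _ => h2 x).trans_eq ?_
    rw [sum_add_distrib, ← mul_sum, ← mul_sum, sum_flipC i (fun x => markProb n u x i ^ 2)]
    ring
  have h2 : ∑ x, ∑ i, markProb n u x i ^ 2 ≤ Real.sqrt (4 * d / (n + 1)) * tal u := by
    refine (sum_le_sum fun x _ => sum_sq_markProb_le hd n u x).trans ?_
    rw [← mul_sum, ← wordAvg_sum]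
    exact mul_le_mul_of_nonneg_left (wordAvg_tal_le_tal hd n u) (Real.sqrt_nonneg _)
  have h3 : Real.sqrt (4 * d / (n + 1)) = 2 * Real.sqrt (d / (n + 1)) := by
    rw [mul_div_assoc, Real.sqrt_mul (by norm_num), show (4 : ℝ) = 2 ^ 2 by norm_num,
      Real.sqrt_sq (by norm_num)]
  rw [h3] at h2
  linarith

lemma wordAvg_ind_srt {d : ℕ} (n : ℕ) (u : (Fin d → Bool) → Bool) (x : Fin d → Bool)
    (i : Fin d) :
    wordAvg d n (fun l => ind (srt i (run l u) x)) = meanVal n u x + drift n u x i := by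
  rw [drift, wordAvg_sub, meanVal]
  ring

lemma meanVal_succ_eq_add_drift {d : ℕ} (hd : 0 < d) (n : ℕ) (u : (Fin d → Bool) → Bool)
    (x : Fin d → Bool) :
    meanVal (n + 1) u x = meanVal n u x + 1 / (2 * d : ℝ) * ∑ i, drift n u x i := by
  have h0 : (d : ℝ) ≠ 0 := by positivity
  rw [meanVal, wordAvg_add_steps]
  simp only [wordAvg_one, run_append, run_nil, run_cons]
  rw [wordAvg_mul, wordAvg_sum]
  simp only [wordAvg_add, wordAvg_ind_srt]
  rw [sum_add_distrib, sum_add_distrib, sum_const, card_univ, Fintype.card_fin, nsmul_eq_mul]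
  change _ * (d * meanVal n u x + _ + ∑ i : Fin d, meanVal n u x) = _
  rw [sum_const, card_univ, Fintype.card_fin, nsmul_eq_mul]
  field_simp
  ring

lemma wordAvg_mul_wordAvg {d : ℕ} (n : ℕ) (F G : List (Fin d) → ℝ) :
    wordAvg d n F * wordAvg d n G = wordAvg d n (fun l => wordAvg d n (fun l' => F l * G l')) := by
  simp only [wordAvg_mul]
  rw [mul_comm, ← wordAvg_mul]
  simp only [mul_comm]

lemma sum_sq_meanVal {d : ℕ} (n : ℕ) (u : (Fin d → Bool) → Bool) :
    ∑ x, meanVal n u x ^ 2 =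
      wordAvg d n (fun l => wordAvg d n (fun l' => ∑ x, ind (run l u x) * ind (run l' u x))) := by
  simp only [wordAvg_sum, ← wordAvg_mul_wordAvg, sq]
  rfl

lemma sum_sq_meanVal_le {d : ℕ} (n : ℕ) (u : (Fin d → Bool) → Bool) (i : Fin d) :
    ∑ x, meanVal n u x ^ 2 ≤ ∑ x, (meanVal n u x + drift n u x i) ^ 2 := by
  have h : ∑ x, (meanVal n u x + drift n u x i) ^ 2 = wordAvg d n (fun l => wordAvg d n (fun l' =>
      ∑ x, ind (srt i (run l u) x) * ind (srt i (run l' u) x))) := by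
    simp only [wordAvg_sum, ← wordAvg_mul_wordAvg, sq, wordAvg_ind_srt]
  rw [h, sum_sq_meanVal]
  exact wordAvg_mono n fun l => wordAvg_mono n fun l' => sum_mul_le_sum_srt_mul i _ _

lemma sum_sq_meanVal_succ_ge {d : ℕ} (hd : 0 < d) (n : ℕ) (u : (Fin d → Bool) → Bool) :
    ∑ x, meanVal n u x ^ 2 - 1 / (2 * d : ℝ) * ∑ i, ∑ x, drift n u x i ^ 2 ≤
      ∑ x, meanVal (n + 1) u x ^ 2 := by
  have h1 : ∀ x, meanVal n u x ^ 2 +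
      1 / (2 * d : ℝ) * ∑ i, 2 * (meanVal n u x * drift n u x i) ≤ meanVal (n + 1) u x ^ 2 := by
    intro x
    rw [meanVal_succ_eq_add_drift hd, ← mul_sum, ← mul_sum]
    nlinarith [sq_nonneg (1 / (2 * d : ℝ) * ∑ i, drift n u x i)]
  have h2 := sum_le_sum fun x (_ : x ∈ univ) => h1 x
  rw [sum_add_distrib, ← mul_sum, sum_comm] at h2
  have h3 : -∑ i, ∑ x, drift n u x i ^ 2 ≤ ∑ i, ∑ x, 2 * (meanVal n u x * drift n u x i) := by
    rw [← sum_neg_distrib]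
    refine sum_le_sum fun i _ => ?_
    have h4 := sum_sq_meanVal_le n u i
    have h5 : ∑ x, (meanVal n u x + drift n u x i) ^ 2 = ∑ x, meanVal n u x ^ 2 +
        ∑ x, 2 * (meanVal n u x * drift n u x i) + ∑ x, drift n u x i ^ 2 := by
      rw [← sum_add_distrib, ← sum_add_distrib]
      exact sum_congr rfl fun x _ => by ring
    linarith
  have h6 : (0 : ℝ) ≤ 1 / (2 * d : ℝ) := by positivity
  nlinarith [mul_le_mul_of_nonneg_left h3 h6]

lemma sqrt_mul_sub_sum_sq_meanVal_le {d : ℕ} (hd : 0 < d) (n : ℕ) (u : (Fin d → Bool) → Bool) :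
    Real.sqrt d * (∑ x, ind (u x) - ∑ x, meanVal n u x ^ 2) ≤ 8 * Real.sqrt n * tal u := by
  induction n with
  | zero => simp [meanVal, wordAvg_zero, run_nil, ind_sq]
  | succ n ih =>
    have h1 := sum_sq_meanVal_succ_ge hd n u
    have h2 := sum_sq_drift_le hd n u
    have ht := tal_nonneg u
    rw [Real.sqrt_div (by positivity)] at h2
    push_cast
    have hd2 : Real.sqrt d ^ 2 = d := Real.sq_sqrt (by positivity)
    have hn2 : Real.sqrt n ^ 2 = n := Real.sq_sqrt (by positivity)
    have hm2 : Real.sqrt (n + 1) ^ 2 = n + 1 := Real.sq_sqrt (by positivity)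
    have hd0 : 0 < Real.sqrt d := Real.sqrt_pos.2 (by exact_mod_cast hd)
    have hn0 : 0 ≤ Real.sqrt n := Real.sqrt_nonneg _
    have hm0 : 0 < Real.sqrt (n + 1) := Real.sqrt_pos.2 (by positivity)
    generalize Real.sqrt d = D at *
    generalize Real.sqrt (n + 1) = M at *
    generalize Real.sqrt n = N at *
    rw [← hd2] at h1
    have h3 : D * (1 / (2 * D ^ 2) * (8 * (D / M) * tal u)) = 4 / M * tal u := by
      field_simp
      ring
    have h4 : D * (1 / (2 * D ^ 2) * ∑ i, ∑ x, drift n u x i ^ 2) ≤ 4 / M * tal u := by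
      rw [← h3]
      gcongr
    have h5 : 4 / M ≤ 8 * (M - N) := by
      rw [div_le_iff₀ hm0]
      nlinarith [sq_nonneg (M - N)]
    nlinarith [mul_le_mul_of_nonneg_right h5 ht, mul_le_mul_of_nonneg_left h1 hd0.le]

lemma wordAvg_hd_run_run_le {d : ℕ} (hd0 : 0 < d) (n : ℕ) (u : (Fin d → Bool) → Bool) :
    Real.sqrt d * wordAvg d n (fun l => wordAvg d n (fun l' => hd (run l u) (run l' u))) ≤
      16 * Real.sqrt n * tal u := by
  simp only [hd_eq, sum_ind_run, wordAvg_sub, wordAvg_mul, wordAvg_const hd0]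
  rw [← sum_sq_meanVal]
  linarith [sqrt_mul_sub_sum_sq_meanVal_le hd0 n u]

/-! ### The expected distance to the sorted function -/

lemma wordAvg_hd_double_le {d : ℕ} (hd0 : 0 < d) (n : ℕ) (u : (Fin d → Bool) → Bool) :
    Real.sqrt d * wordAvg d (n + n) (fun l => hd u (run l u)) ≤
      Real.sqrt d * wordAvg d n (fun l => hd u (run l u)) + 32 * Real.sqrt n * tal u := by
  have h : wordAvg d (n + n) (fun l => hd u (run l u)) ≤ wordAvg d n (fun l => hd u (run l u)) +
      2 * wordAvg d n (fun l => wordAvg d n (fun l' => hd (run l u) (run l' u))) := by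
    rw [wordAvg_add_steps, ← wordAvg_mul, ← wordAvg_add]
    refine wordAvg_mono n fun l => ?_
    have e : hd u (run l u) = wordAvg d n (fun _ => hd u (run l u)) := (wordAvg_const hd0 n _).symm
    rw [e, ← wordAvg_mul, ← wordAvg_add]
    refine wordAvg_mono n fun l' => ?_
    have h1 := hd_triangle u (run l u) (run (l ++ l') u)
    have h2 := hd_triangle (run l u) (run l' u) (run (l ++ l') u)
    have h3 := hd_run_le l' (run l' u) (run l u)
    rw [run_run_self, ← run_append, hd_comm (run l' u) (run l u)] at h3
    linarith
  nlinarith [mul_le_mul_of_nonneg_left h (Real.sqrt_nonneg d), wordAvg_hd_run_run_le hd0 n u]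

lemma card_le_mul_sqrt_card {d : ℕ} (s : Finset (Fin d)) : (#s : ℝ) ≤ d * Real.sqrt #s := by
  have h1 : (#s : ℝ) ≤ d := by exact_mod_cast card_finset_fin_le s
  rcases s.eq_empty_or_nonempty with rfl | hs
  · simp
  have h2 : (1 : ℝ) ≤ Real.sqrt #s := by
    rw [Real.one_le_sqrt]
    exact_mod_cast hs.card_pos
  nlinarith

lemma sum_hd_srt_le {d : ℕ} (u : (Fin d → Bool) → Bool) :
    ∑ i, hd u (srt i u) ≤ 2 * d * tal u := by
  have h1 : ∀ i, hd u (srt i u) ≤ 2 * ∑ x, ind (decide (i ∈ optMarking u x)) := by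
    intro i
    have h2 : ∀ x, ind (xor (u x) (srt i u x)) ≤
        ind (decide (i ∈ optMarking u x)) + ind (decide (i ∈ optMarking u (flipC x i))) := by
      intro x
      rw [Bool.xor_comm, ← viol]
      cases h : viol u x i
      · exact add_nonneg (ind_nonneg _) (ind_nonneg _)
      · rcases (isMarking_optMarking u x i).2 h with h1 | h1
        · simp only [h1, decide_true]
          exact le_add_of_nonneg_right (ind_nonneg _)
        · simp only [h1, decide_true]
          exact le_add_of_nonneg_left (ind_nonneg _)
    refine (sum_le_sum fun x _ => h2 x).trans_eq ?_
    rw [sum_add_distrib, sum_flipC i (fun x => ind (decide (i ∈ optMarking u x)))]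
    ring
  refine (sum_le_sum fun i _ => h1 i).trans ?_
  rw [← mul_sum, sum_comm, mul_assoc]
  refine mul_le_mul_of_nonneg_left ?_ (by norm_num)
  rw [tal, cost, mul_sum]
  refine sum_le_sum fun x _ => ?_
  refine le_trans (le_of_eq ?_) (card_le_mul_sqrt_card _)
  simp [ind]

lemma wordAvg_hd_two_pow_le {d : ℕ} (hd0 : 0 < d) (k : ℕ) (u : (Fin d → Bool) → Bool) :
    Real.sqrt d * wordAvg d (2 ^ k) (fun l => hd u (run l u)) ≤
      (Real.sqrt d + 80 * Real.sqrt (2 ^ k)) * tal u := by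
  have ht := tal_nonneg u
  induction k with
  | zero =>
    have h1 : wordAvg d 1 (fun l => hd u (run l u)) ≤ tal u := by
      rw [wordAvg_one, sum_add_distrib]
      have h2 : hd u u = 0 := by simp [hd, ind]
      simp only [h2, run_cons, run_nil, sum_const_zero, add_zero]
      have h3 : (0 : ℝ) < 2 * d := by positivity
      rw [one_div, inv_mul_le_iff₀ h3]
      exact sum_hd_srt_le u
    have h2 := mul_le_mul_of_nonneg_left h1 (Real.sqrt_nonneg d)
    rw [pow_zero, pow_zero, Real.sqrt_one]
    linarith
  | succ k ih =>
    have h1 := wordAvg_hd_double_le hd0 (2 ^ k) u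
    rw [← two_mul, ← pow_succ'] at h1
    push_cast at h1
    have h2 : 112 / 80 ≤ Real.sqrt 2 := by
      apply Real.le_sqrt_of_sq_le
      norm_num
    have h3 : Real.sqrt (2 ^ (k + 1)) = Real.sqrt 2 * Real.sqrt (2 ^ k) := by
      rw [pow_succ', Real.sqrt_mul (by norm_num)]
    rw [h3]
    have h4 := Real.sqrt_nonneg (2 ^ k)
    have h5 := mul_nonneg h4 ht
    nlinarith [mul_le_mul_of_nonneg_right h2 h5]

lemma exists_steps {d : ℕ} (hd0 : 0 < d) : ∃ n : ℕ, ∀ u : (Fin d → Bool) → Bool,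
    wordAvg d n (fun l => hd u (run l u)) ≤ 81 * tal u ∧
    wordAvg d n (fun l => tal (run l u)) ≤ 8 / 9 * tal u := by
  refine ⟨2 ^ Nat.log 2 d, fun u => ⟨?_, ?_⟩⟩
  · have h1 := wordAvg_hd_two_pow_le hd0 (Nat.log 2 d) u
    have h2 : Real.sqrt (2 ^ Nat.log 2 d) ≤ Real.sqrt d := by
      apply Real.sqrt_le_sqrt
      exact_mod_cast Nat.pow_log_le_self 2 hd0.ne'
    have h3 : 0 < Real.sqrt d := Real.sqrt_pos.2 (by exact_mod_cast hd0)
    have h4 := mul_le_mul_of_nonneg_right h2 (tal_nonneg u)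
    refine le_of_mul_le_mul_left ?_ h3
    nlinarith
  · refine (wordAvg_tal_le hd0 _ u).trans (mul_le_mul_of_nonneg_right ?_ (tal_nonneg u))
    have hdp : (0 : ℝ) < d := by exact_mod_cast hd0
    have h1 : (1 : ℝ) ≤ d := by exact_mod_cast hd0
    have h0 : (0 : ℝ) ≤ 1 - 1 / (4 * d : ℝ) := by
      rw [sub_nonneg, div_le_one (by positivity)]
      linarith
    have h2 : 1 - 1 / (4 * d : ℝ) ≤ Real.exp (-(1 / (4 * d : ℝ))) := by
      linarith [Real.add_one_le_exp (-(1 / (4 * d : ℝ)))]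
    have h3 : (d : ℝ) / 2 ≤ 2 ^ Nat.log 2 d := by
      have := Nat.lt_pow_succ_log_self (b := 2) (by norm_num) d
      rw [pow_succ] at this
      have h4 : (d : ℝ) < 2 ^ Nat.log 2 d * 2 := by exact_mod_cast this
      linarith
    calc (1 - 1 / (4 * d : ℝ)) ^ (2 ^ Nat.log 2 d)
        ≤ Real.exp (-(1 / (4 * d : ℝ))) ^ (2 ^ Nat.log 2 d) := pow_le_pow_left₀ h0 h2 _
      _ = Real.exp (-(2 ^ Nat.log 2 d / (4 * d : ℝ))) := by
          rw [← Real.exp_nat_mul]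
          congr 1
          push_cast
          ring
      _ ≤ Real.exp (-(1 / 8)) := by
          apply Real.exp_le_exp.2
          rw [neg_le_neg_iff, div_le_div_iff₀ (by norm_num) (by positivity)]
          linarith
      _ ≤ 8 / 9 := by
          rw [Real.exp_neg, inv_le_comm₀ (Real.exp_pos _) (by norm_num)]
          have := Real.add_one_le_exp (1 / 8 : ℝ)
          norm_num at this ⊢
          linarith

/-! ### The robust Talagrand inequality for disjoint violated pairs -/

/-- The number of pairs `(s a, t a)` violated by `u`. -/
noncomputable def pairViol {d : ℕ} {ι : Type*} [Fintype ι] (s t : ι → Fin d → Bool)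
    (u : (Fin d → Bool) → Bool) : ℝ :=
  ∑ a, ind (u (s a) && !u (t a))

lemma sum_comp_le_of_injective {d : ℕ} {ι : Type*} [Fintype ι] {s : ι → Fin d → Bool}
    (hs : Function.Injective s) {F : (Fin d → Bool) → ℝ} (hF : ∀ x, 0 ≤ F x) :
    ∑ a, F (s a) ≤ ∑ x, F x := by
  classical
  rw [← sum_image (s := univ) (f := F) (g := s) fun a _ b _ h => hs h]
  exact sum_le_sum_of_subset_of_nonneg (subset_univ _) fun x _ _ => hF x

lemma pairViol_le {d : ℕ} {ι : Type*} [Fintype ι] {s t : ι → Fin d → Bool}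
    (hs : Function.Injective s) (ht : Function.Injective t) (u v : (Fin d → Bool) → Bool) :
    pairViol s t u ≤ 2 * hd u v + pairViol s t v := by
  have h1 : ∀ a, ind (u (s a) && !u (t a)) ≤ ind (v (s a) && !v (t a)) +
      (ind (xor (u (s a)) (v (s a))) + ind (xor (u (t a)) (v (t a)))) := by
    intro a
    cases u (s a) <;> cases v (s a) <;> cases u (t a) <;> cases v (t a) <;> norm_num [ind]
  have h2 := sum_le_sum fun a (_ : a ∈ univ) => h1 a
  rw [sum_add_distrib, sum_add_distrib] at h2
  have h3 := sum_comp_le_of_injective hs (F := fun x => ind (xor (u x) (v x)))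
    fun x => ind_nonneg _
  have h4 := sum_comp_le_of_injective ht (F := fun x => ind (xor (u x) (v x)))
    fun x => ind_nonneg _
  change ∑ a, ind (u (s a) && !u (t a)) ≤ 2 * (∑ x, ind (xor (u x) (v x))) +
    ∑ a, ind (v (s a) && !v (t a))
  linarith

lemma le_of_forall_viol_eq_false {d : ℕ} {u : (Fin d → Bool) → Bool}
    (h : ∀ x i, viol u x i = false) {x y : Fin d → Bool} (hxy : ∀ i, x i ≤ y i) : u x ≤ u y := by
  classical
  induction hk : #{i | x i ≠ y i} generalizing x with
  | zero =>
    have : x = y := by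
      funext i
      by_contra hi
      rw [card_eq_zero, filter_eq_empty_iff] at hk
      exact hk (mem_univ i) hi
    rw [this]
  | succ k ih =>
    obtain ⟨i, hi⟩ := card_pos.1 (show 0 < #{i | x i ≠ y i} by omega)
    rw [mem_filter] at hi
    have hxi : x i = false := by
      have h1 := hxy i
      have h2 := hi.2
      revert h1 h2
      cases x i <;> cases y i <;> simp
    have hyi : y i = true := by
      have h2 := hi.2
      rw [hxi] at h2
      revert h2
      cases y i <;> simp
    have h1 := h x i
    rw [viol_eq, hxi] at h1
    refine le_trans (b := u (flipC x i)) ?_ (ih (fun j => ?_) ?_)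
    · revert h1
      cases u x <;> cases u (flipC x i) <;> simp
    · rcases eq_or_ne j i with rfl | hj
      · rw [hyi]
        exact Bool.le_true _
      · rw [flipC_apply_ne x hj]
        exact hxy j
    · have : (univ.filter fun j => flipC x i j ≠ y j) = (univ.filter fun j => x j ≠ y j).erase i := by
        ext j
        rcases eq_or_ne j i with rfl | hj
        · simp [flipC_apply_self, hxi, hyi]
        · simp [flipC_apply_ne x hj, hj]
      rw [this, card_erase_of_mem (by simpa using hi.2), hk]
      rfl

lemma one_le_tal {d : ℕ} {u : (Fin d → Bool) → Bool} {x : Fin d → Bool} {i : Fin d}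
    (h : viol u x i = true) : 1 ≤ tal u := by
  have key : ∀ y, i ∈ optMarking u y → 1 ≤ tal u := by
    intro y hy
    have h1 : (1 : ℝ) ≤ Real.sqrt #(optMarking u y) := by
      rw [Real.one_le_sqrt]
      exact_mod_cast card_pos.2 ⟨i, hy⟩
    exact h1.trans (single_le_sum (f := fun y => Real.sqrt #(optMarking u y))
      (fun _ _ => Real.sqrt_nonneg _) (mem_univ y))
  rcases (isMarking_optMarking u x i).2 h with h1 | h1
  · exact key _ h1
  · exact key _ h1

lemma pairViol_le_tal {d : ℕ} (hd0 : 0 < d) {ι : Type*} [Fintype ι] {s t : ι → Fin d → Bool}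
    (hs : Function.Injective s) (ht : Function.Injective t) (hst : ∀ a i, s a i ≤ t a i)
    (u : (Fin d → Bool) → Bool) : pairViol s t u ≤ 1458 * tal u := by
  obtain ⟨n, hn⟩ := exists_steps hd0
  have hB : ∀ u, pairViol s t u ≤ Fintype.card ι := by
    intro u
    refine (sum_le_sum fun a _ => ind_le_one _).trans_eq ?_
    simp
  have key : ∀ j : ℕ, ∀ u, pairViol s t u ≤
      (1458 + Fintype.card ι * (8 / 9 : ℝ) ^ j) * tal u := by
    intro j
    induction j with
    | zero =>
      intro u
      by_cases h : ∀ x i, viol u x i = false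
      · have h0 : pairViol s t u = 0 := by
          refine sum_eq_zero fun a _ => ?_
          have := le_of_forall_viol_eq_false h (hst a)
          revert this
          cases u (s a) <;> cases u (t a) <;> simp [ind]
        rw [h0]
        exact mul_nonneg (by positivity) (tal_nonneg u)
      · push Not at h
        obtain ⟨x, i, h⟩ := h
        have h1 := one_le_tal (by simpa using h : viol u x i = true)
        have h2 : (0 : ℝ) ≤ Fintype.card ι := by positivity
        nlinarith [hB u]
    | succ j ih =>
      intro u
      have h1 : pairViol s t u ≤ 2 * wordAvg d n (fun l => hd u (run l u)) +
          (1458 + Fintype.card ι * (8 / 9 : ℝ) ^ j) * wordAvg d n (fun l => tal (run l u)) := by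
        rw [← wordAvg_mul, ← wordAvg_mul, ← wordAvg_add, ← wordAvg_const hd0 n (pairViol s t u)]
        exact wordAvg_mono n fun l => (pairViol_le hs ht u (run l u)).trans (by linarith [ih (run l u)])
      have h2 : 0 ≤ 1458 + Fintype.card ι * (8 / 9 : ℝ) ^ j := by positivity
      have h3 := mul_le_mul_of_nonneg_left (hn u).2 h2
      have h4 := (hn u).1
      rw [pow_succ]
      linarith
  have hlim : Filter.Tendsto (fun j : ℕ => (1458 + Fintype.card ι * (8 / 9 : ℝ) ^ j) * tal u)
      Filter.atTop (nhds ((1458 + Fintype.card ι * 0) * tal u)) := by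
    refine Filter.Tendsto.mul_const _ (Filter.Tendsto.const_add _ (Filter.Tendsto.const_mul _ ?_))
    exact tendsto_pow_atTop_nhds_zero_of_lt_one (by norm_num) (by norm_num)
  rw [mul_zero, add_zero] at hlim
  exact ge_of_tendsto' hlim fun j => key j u

/-! ### Extremal assignments and violated pairs -/

section Assignment

variable {α : Type*} [PartialOrder α]

/-- The gain of the assignment `σ` at `x`. -/
noncomputable def gain (f : α → ℝ) (σ : Equiv.Perm α) (x : α) : ℝ :=
  open Classical in if x ≤ σ x then max (f x - f (σ x)) 0 else 0

lemma gain_nonneg (f : α → ℝ) (σ : Equiv.Perm α) (x : α) : 0 ≤ gain f σ x := by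
  unfold gain
  split_ifs
  · exact le_max_right _ _
  · exact le_rfl

lemma sub_le_gain {f : α → ℝ} {σ : Equiv.Perm α} {x : α} (h : x ≤ σ x) :
    f x - f (σ x) ≤ gain f σ x := by
  rw [gain, if_pos h]
  exact le_max_left _ _

variable [Fintype α]

/-- The points assigned by `σ` to a larger point of smaller value. -/
noncomputable def gainSet (f : α → ℝ) (σ : Equiv.Perm α) : Finset α :=
  open Classical in {x | x ≤ σ x ∧ f (σ x) < f x}

lemma mem_gainSet {f : α → ℝ} {σ : Equiv.Perm α} {x : α} :
    x ∈ gainSet f σ ↔ x ≤ σ x ∧ f (σ x) < f x := by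
  simp [gainSet]

lemma gain_eq_of_mem {f : α → ℝ} {σ : Equiv.Perm α} {x : α} (h : x ∈ gainSet f σ) :
    gain f σ x = f x - f (σ x) := by
  rw [mem_gainSet] at h
  rw [gain, if_pos h.1, max_eq_left (by linarith)]

lemma gain_eq_zero_of_notMem {f : α → ℝ} {σ : Equiv.Perm α} {x : α} (h : x ∉ gainSet f σ) :
    gain f σ x = 0 := by
  rw [mem_gainSet] at h
  unfold gain
  split_ifs with h1
  · exact max_eq_right (by linarith [not_lt.1 fun h2 => h ⟨h1, h2⟩])
  · rfl

lemma sum_gain (f : α → ℝ) (σ : Equiv.Perm α) :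
    ∑ x, gain f σ x = ∑ x ∈ gainSet f σ, (f x - f (σ x)) := by
  rw [← sum_subset (subset_univ (gainSet f σ)) fun x _ hx => gain_eq_zero_of_notMem hx]
  exact sum_congr rfl fun x hx => gain_eq_of_mem hx

/-- An assignment of largest total gain which, among these, uses the fewest points. -/
def IsExtremal (f : α → ℝ) (σ : Equiv.Perm α) : Prop :=
  (∀ σ', ∑ x, gain f σ' x ≤ ∑ x, gain f σ x) ∧
    ∀ σ', ∑ x, gain f σ' x = ∑ x, gain f σ x → #(gainSet f σ) ≤ #(gainSet f σ')

lemma exists_isExtremal (f : α → ℝ) : ∃ σ : Equiv.Perm α, IsExtremal f σ := by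
  classical
  obtain ⟨σ₀, h₀⟩ := Finite.exists_max (fun σ : Equiv.Perm α => ∑ x, gain f σ x)
  obtain ⟨σ, hσ, h⟩ := Set.exists_min_image {σ | ∑ x, gain f σ x = ∑ x, gain f σ₀ x}
    (fun σ => #(gainSet f σ)) (Set.toFinite _) ⟨σ₀, rfl⟩
  simp only [Set.mem_ofPred_eq] at hσ h
  exact ⟨σ, fun σ' => hσ ▸ h₀ σ', fun σ' h' => h σ' (h'.trans hσ)⟩

/-- Reassigning the points of the gain set among themselves keeps all gains positive. -/
lemma IsExtremal.lt_of_reassign {f : α → ℝ} {σ : Equiv.Perm α} (h : IsExtremal f σ)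
    (τ : Equiv.Perm α) (hτ : ∀ x, τ x ∈ gainSet f σ ↔ x ∈ gainSet f σ)
    (hle : ∀ x ∈ gainSet f σ, x ≤ σ (τ x)) {x : α} (hx : x ∈ gainSet f σ) :
    f (σ (τ x)) < f x := by
  classical
  set σ' : Equiv.Perm α := τ.trans σ with hσ'
  have hσ'a : ∀ y, σ' y = σ (τ y) := fun y => rfl
  have h1 : ∑ y ∈ gainSet f σ, (f y - f (σ' y)) = ∑ y, gain f σ y := by
    rw [sum_gain, sum_sub_distrib, sum_sub_distrib]
    congr 1
    exact sum_equiv τ (fun y => (hτ y).symm) fun y _ => rfl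
  have h2 : ∀ y ∈ gainSet f σ, f y - f (σ' y) ≤ gain f σ' y := fun y hy => sub_le_gain (hle y hy)
  have h3 : ∑ y ∈ gainSet f σ, gain f σ' y ≤ ∑ y, gain f σ' y :=
    sum_le_sum_of_subset_of_nonneg (subset_univ _) fun y _ _ => gain_nonneg f σ' y
  have h4 := h.1 σ'
  have h5 := sum_le_sum h2
  have h6 : ∀ y ∈ gainSet f σ, f y - f (σ' y) = gain f σ' y :=
    (sum_eq_sum_iff_of_le h2).1 (by linarith)
  by_contra hlt
  have h7 : x ∉ gainSet f σ' := fun hx' => hlt (mem_gainSet.1 hx').2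
  have h8 : gainSet f σ' ⊆ (gainSet f σ).erase x := by
    intro y hy
    rw [mem_erase]
    refine ⟨fun e => h7 (e ▸ hy), ?_⟩
    by_contra hy'
    have h9 : gain f σ' y + ∑ z ∈ gainSet f σ, gain f σ' z ≤ ∑ z, gain f σ' z := by
      rw [← sum_insert hy']
      exact sum_le_sum_of_subset_of_nonneg (subset_univ _) fun z _ _ => gain_nonneg f σ' z
    have h10 := gain_eq_of_mem hy
    have h11 := (mem_gainSet.1 hy).2
    linarith
  have h9 := h.2 σ' (by linarith)
  have h10 := card_le_card h8
  rw [card_erase_of_mem hx] at h10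
  have := card_pos.2 ⟨x, hx⟩
  omega

/-- The gain set and its image cover all violated pairs. -/
lemma IsExtremal.cover {f : α → ℝ} {σ : Equiv.Perm α} (h : IsExtremal f σ) {x y : α}
    (hxy : x ≤ y) (hf : f y < f x) : x ∈ gainSet f σ ∨ σ.symm y ∈ gainSet f σ := by
  classical
  by_contra hcon
  push Not at hcon
  obtain ⟨hx, hy⟩ := hcon
  set σ' : Equiv.Perm α := (Equiv.swap x (σ.symm y)).trans σ with hσ'
  have h1 : σ' x = y := by simp [hσ']
  have h2 : ∀ z ∈ gainSet f σ, σ' z = σ z := by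
    intro z hz
    rw [hσ', Equiv.trans_apply, Equiv.swap_apply_of_ne_of_ne]
    · rintro rfl
      exact hx hz
    · rintro rfl
      exact hy hz
  have h3 : gain f σ' x + ∑ z ∈ gainSet f σ, gain f σ' z ≤ ∑ z, gain f σ' z := by
    rw [← sum_insert hx]
    exact sum_le_sum_of_subset_of_nonneg (subset_univ _) fun z _ _ => gain_nonneg f σ' z
  have h4 : ∑ z ∈ gainSet f σ, gain f σ z = ∑ z ∈ gainSet f σ, gain f σ' z :=
    sum_congr rfl fun z hz => by rw [gain, gain, h2 z hz]
  have h5 : ∑ z ∈ gainSet f σ, gain f σ z = ∑ z, gain f σ z :=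
    sum_subset (subset_univ _) fun z _ hz => gain_eq_zero_of_notMem hz
  have h6 := sub_le_gain (f := f) (σ := σ') (x := x) (h1 ▸ hxy)
  rw [h1] at h6
  linarith [h.1 σ']

end Assignment

lemma exists_nodup_chain {α : Type*} {R : α → α → Prop} {a b : α}
    (h : Relation.ReflTransGen R b a) :
    ∃ l : List α, (b :: l).IsChain R ∧ (b :: l).Nodup ∧
      (b :: l).getLast (List.cons_ne_nil b l) = a := by
  classical
  induction h using Relation.ReflTransGen.head_induction_on with
  | refl => exact ⟨[], by simp⟩
  | @head b c hbc _ ih =>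
    obtain ⟨l, h1, h2, h3⟩ := ih
    by_cases hb : b ∈ c :: l
    · obtain ⟨l1, l2, e⟩ := List.append_of_mem hb
      refine ⟨l2, ?_, ?_, ?_⟩
      · rw [e] at h1
        exact h1.right_of_append
      · rw [e] at h2
        exact h2.of_append_right
      · rw [← h3]
        simp [e]
    · exact ⟨c :: l, List.IsChain.cons_cons hbc h1, List.nodup_cons.2 ⟨hb, h2⟩, by simpa using h3⟩

/-- A closed walk yields a permutation moving every point along the relation. -/
lemma exists_perm_of_reflTransGen {α : Type*} {R : α → α → Prop} {a b : α}
    (h : Relation.ReflTransGen R b a) (hab : R a b) :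
    ∃ τ : Equiv.Perm α, τ a = b ∧ ∀ x, τ x = x ∨ R x (τ x) := by
  classical
  obtain ⟨l, h1, h2, h3⟩ := exists_nodup_chain h
  refine ⟨(b :: l).formPerm, ?_, fun x => ?_⟩
  · rw [← h3, List.formPerm_apply_getLast]
  · by_cases hx : x ∈ b :: l
    · right
      obtain ⟨i, hi, rfl⟩ := List.getElem_of_mem hx
      by_cases hlast : i + 1 < (b :: l).length
      · rw [List.formPerm_apply_lt_getElem _ h2 i hlast]
        exact List.isChain_iff_getElem.1 h1 i hlast
      · have e : (b :: l)[i] = (b :: l).getLast (List.cons_ne_nil b l) := by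
          rw [List.getLast_eq_getElem]
          congr 1
          omega
        rw [e, List.formPerm_apply_getLast, h3]
        exact hab
    · left
      exact List.formPerm_apply_of_notMem hx

/-! ### Splitting into strongly connected classes -/

section Classes

variable {α : Type*} [Fintype α] [PartialOrder α]

/-- The point `x` of the gain set lies below the point assigned to `y`. -/
def Link (f : α → ℝ) (σ : Equiv.Perm α) (x y : α) : Prop :=
  x ∈ gainSet f σ ∧ y ∈ gainSet f σ ∧ x ≤ σ y

/-- The strongly connected class of `x`. -/
noncomputable def cls (f : α → ℝ) (σ : Equiv.Perm α) (x : α) : Finset α :=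
  open Classical in
  {y | Relation.ReflTransGen (Link f σ) x y ∧ Relation.ReflTransGen (Link f σ) y x}

lemma mem_cls {f : α → ℝ} {σ : Equiv.Perm α} {x y : α} : y ∈ cls f σ x ↔
    Relation.ReflTransGen (Link f σ) x y ∧ Relation.ReflTransGen (Link f σ) y x := by
  simp [cls]

lemma cls_eq_iff {f : α → ℝ} {σ : Equiv.Perm α} {x y : α} : cls f σ x = cls f σ y ↔
    Relation.ReflTransGen (Link f σ) x y ∧ Relation.ReflTransGen (Link f σ) y x := by
  constructor
  · intro h
    have h1 : y ∈ cls f σ y := mem_cls.2 ⟨.refl, .refl⟩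
    rw [← h] at h1
    exact mem_cls.1 h1
  · rintro ⟨h1, h2⟩
    ext z
    rw [mem_cls, mem_cls]
    exact ⟨fun h => ⟨h2.trans h.1, h.2.trans h1⟩, fun h => ⟨h1.trans h.1, h.2.trans h2⟩⟩

lemma IsExtremal.lt_of_link {f : α → ℝ} {σ : Equiv.Perm α} (h : IsExtremal f σ) {x y : α}
    (hxy : Link f σ x y) (hc : cls f σ x = cls f σ y) : f (σ y) < f x := by
  obtain ⟨τ, h1, h2⟩ := exists_perm_of_reflTransGen (cls_eq_iff.1 hc).2 hxy
  rw [← h1]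
  refine h.lt_of_reassign τ (fun z => ?_) (fun z hz => ?_) hxy.1
  · rcases h2 z with h3 | h3
    · rw [h3]
    · exact ⟨fun _ => h3.1, fun _ => h3.2.1⟩
  · rcases h2 z with h3 | h3
    · rw [h3]
      exact (mem_gainSet.1 hz).1
    · exact h3.2.2

/-- The Boolean function attached to the class `k`. -/
noncomputable def clsFun (f : α → ℝ) (σ : Equiv.Perm α) (k : Finset α) (z : α) : Bool :=
  open Classical in
  decide ((∃ s ∈ gainSet f σ, cls f σ s = k ∧ s ≤ z) ∧
    ∀ t ∈ gainSet f σ, cls f σ t = k → z ≤ σ t → f (σ t) < f z)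

lemma clsFun_eq_true_iff {f : α → ℝ} {σ : Equiv.Perm α} {k : Finset α} {z : α} :
    clsFun f σ k z = true ↔ (∃ s ∈ gainSet f σ, cls f σ s = k ∧ s ≤ z) ∧
      ∀ t ∈ gainSet f σ, cls f σ t = k → z ≤ σ t → f (σ t) < f z := by
  simp [clsFun]

lemma IsExtremal.clsFun_left {f : α → ℝ} {σ : Equiv.Perm α} (h : IsExtremal f σ) {s : α}
    (hs : s ∈ gainSet f σ) : clsFun f σ (cls f σ s) s = true := by
  rw [clsFun_eq_true_iff]
  exact ⟨⟨s, hs, rfl, le_rfl⟩, fun t ht hc hle => h.lt_of_link ⟨hs, ht, hle⟩ hc.symm⟩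

lemma clsFun_right {f : α → ℝ} {σ : Equiv.Perm α} {s : α}
    (hs : s ∈ gainSet f σ) : clsFun f σ (cls f σ s) (σ s) = false := by
  rw [← Bool.not_eq_true, clsFun_eq_true_iff]
  exact fun h => lt_irrefl _ (h.2 s hs rfl le_rfl)

/-- The point `z` lies in an interval spanned by the class `k`. -/
def InSpan (f : α → ℝ) (σ : Equiv.Perm α) (k : Finset α) (z : α) : Prop :=
  ∃ s ∈ gainSet f σ, ∃ t ∈ gainSet f σ, cls f σ s = k ∧ cls f σ t = k ∧ s ≤ z ∧ z ≤ σ t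

lemma InSpan.unique {f : α → ℝ} {σ : Equiv.Perm α} {k k' : Finset α} {z : α}
    (h : InSpan f σ k z) (h' : InSpan f σ k' z) : k = k' := by
  obtain ⟨s, hs, t, ht, hsk, htk, hsz, hzt⟩ := h
  obtain ⟨s', hs', t', ht', hsk', htk', hsz', hzt'⟩ := h'
  have h1 : Link f σ s t' := ⟨hs, ht', hsz.trans hzt'⟩
  have h2 : Link f σ s' t := ⟨hs', ht, hsz'.trans hzt⟩
  have h3 := (cls_eq_iff.1 (htk.trans hsk.symm)).1
  have h4 := (cls_eq_iff.1 (htk'.trans hsk'.symm)).1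
  rw [← hsk, ← hsk', cls_eq_iff]
  exact ⟨(Relation.ReflTransGen.single h1).trans h4, (Relation.ReflTransGen.single h2).trans h3⟩

lemma clsFun_violation {f : α → ℝ} {σ : Equiv.Perm α} {k : Finset α} {z w : α} (hzw : z ≤ w)
    (hz : clsFun f σ k z = true) (hw : clsFun f σ k w = false) :
    f w < f z ∧ InSpan f σ k z ∧ InSpan f σ k w := by
  rw [clsFun_eq_true_iff] at hz
  rw [← Bool.not_eq_true, clsFun_eq_true_iff] at hw
  obtain ⟨⟨s, hs, hsk, hsz⟩, hz⟩ := hz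
  have h1 : ∃ t ∈ gainSet f σ, cls f σ t = k ∧ w ≤ σ t ∧ f w ≤ f (σ t) := by
    by_contra hcon
    push Not at hcon
    exact hw ⟨⟨s, hs, hsk, hsz.trans hzw⟩, hcon⟩
  obtain ⟨t, ht, htk, hwt, hft⟩ := h1
  exact ⟨hft.trans_lt (hz t ht htk (hzw.trans hwt)), ⟨s, hs, t, ht, hsk, htk, hsz, hzw.trans hwt⟩,
    ⟨s, hs, t, ht, hsk, htk, hsz.trans hzw, hwt⟩⟩

lemma exists_monotone_extension_of_finite {f : α → ℝ} {s : Set α} (h : MonotoneOn f s) :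
    ∃ g : α → ℝ, Monotone g ∧ Set.EqOn f g s := by
  classical
  obtain ⟨a, ha⟩ := (Set.toFinite (Set.range f)).bddBelow
  have hne : ∀ x, (insert a (image f {y | y ≤ x ∧ y ∈ s})).Nonempty := fun x => insert_nonempty _ _
  refine ⟨fun x => (insert a (image f {y | y ≤ x ∧ y ∈ s})).max' (hne x), fun x y hxy => ?_,
    fun x hx => le_antisymm ?_ ?_⟩
  · refine max'_subset _ (insert_subset_insert _ (image_subset_image fun z hz => ?_))
    rw [mem_filter] at hz ⊢
    exact ⟨hz.1, hz.2.1.trans hxy, hz.2.2⟩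
  · exact le_max' _ _ (mem_insert_of_mem (mem_image_of_mem _ (by simp [hx])))
  · refine max'_le _ _ _ fun z hz => ?_
    rcases mem_insert.1 hz with rfl | hz
    · exact ha ⟨x, rfl⟩
    · obtain ⟨y, hy, rfl⟩ := mem_image.1 hz
      rw [mem_filter] at hy
      exact h hy.2.2 hx hy.2.1

/-- The distance to monotonicity is at most twice the size of the gain set. -/
lemma IsExtremal.exists_monotone {f : α → ℝ} {σ : Equiv.Perm α} (h : IsExtremal f σ) :
    ∃ g : α → ℝ, Monotone g ∧ Nat.card {x // f x ≠ g x} ≤ 2 * #(gainSet f σ) := by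
  classical
  set C : Finset α := gainSet f σ ∪ (gainSet f σ).image σ with hC
  have hmono : MonotoneOn f {x | x ∉ C} := by
    intro x hx y hy hxy
    by_contra hlt
    rcases h.cover hxy (not_le.1 hlt) with h1 | h1
    · exact hx (mem_union_left _ h1)
    · exact hy (mem_union_right _ (mem_image.2 ⟨_, h1, by simp⟩))
  obtain ⟨g, hg, hfg⟩ := exists_monotone_extension_of_finite hmono
  refine ⟨g, hg, ?_⟩
  rw [Nat.card_eq_fintype_card, Fintype.card_subtype]
  have h1 : (univ.filter fun x => f x ≠ g x) ⊆ C := by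
    intro x hx
    rw [mem_filter] at hx
    by_contra hxC
    exact hx.2 (hfg hxC)
  calc _ ≤ #C := card_le_card h1
    _ ≤ #(gainSet f σ) + #((gainSet f σ).image σ) := card_union_le _ _
    _ ≤ _ := by
      have := card_image_le (s := gainSet f σ) (f := σ)
      omega

end Classes

lemma le_flipC {d : ℕ} {x : Fin d → Bool} {i : Fin d} (h : x i = false) : x ≤ flipC x i := by
  intro j
  rcases eq_or_ne j i with rfl | hj
  · rw [h]
    exact Bool.false_le _
  · rw [flipC_apply_ne x hj]

lemma flipC_le {d : ℕ} {x : Fin d → Bool} {i : Fin d} (h : x i = true) : flipC x i ≤ x := by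
  intro j
  rcases eq_or_ne j i with rfl | hj
  · rw [h]
    exact Bool.le_true _
  · rw [flipC_apply_ne x hj]

lemma edgeViol_of_viol_clsFun {d : ℕ} {f : (Fin d → Bool) → ℝ}
    {σ : Equiv.Perm (Fin d → Bool)} {k : Finset (Fin d → Bool)} {x : Fin d → Bool} {i : Fin d}
    (h : viol (clsFun f σ k) x i = true) : EdgeViol f x i ∧ InSpan f σ k x := by
  rw [viol_eq] at h
  cases hx : x i
  · have h1 : clsFun f σ k x = true ∧ clsFun f σ k (flipC x i) = false := by simpa [hx] using h
    have h2 := clsFun_violation (le_flipC hx) h1.1 h1.2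
    exact ⟨Or.inl ⟨hx, h2.1⟩, h2.2.1⟩
  · have h1 : clsFun f σ k x = false ∧ clsFun f σ k (flipC x i) = true := by simpa [hx] using h
    have h2 := clsFun_violation (flipC_le hx) h1.2 h1.1
    exact ⟨Or.inr ⟨hx, h2.1⟩, h2.2.2⟩

/-- The robust Talagrand inequality for real-valued functions. -/
theorem distMono_le_sum_sqrt {d : ℕ} (hd0 : 0 < d) (f : (Fin d → Bool) → ℝ)
    (m : (Fin d → Bool) → Finset (Fin d))
    (hm : ∀ x i, EdgeViol f x i → i ∈ m x ∨ i ∈ m (flipC x i)) :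
    distMono d f * 2 ^ d ≤ 2916 * ∑ x, Real.sqrt #(m x) := by
  classical
  obtain ⟨σ, hσ⟩ := exists_isExtremal f
  set K : Finset (Finset (Fin d → Bool)) := (gainSet f σ).image (cls f σ) with hK
  set mk : Finset (Fin d → Bool) → (Fin d → Bool) → Finset (Fin d) :=
    fun k x => {i ∈ m x | viol (clsFun f σ k) x i = true} with hmk
  have h1 : ∀ k ∈ K, (#{s ∈ gainSet f σ | cls f σ s = k} : ℝ) ≤ 1458 * cost (mk k) := by
    intro k _
    have hp := pairViol_le_tal hd0 (ι := {s // s ∈ gainSet f σ ∧ cls f σ s = k})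
      (s := fun a => a.1) (t := fun a => σ a.1) Subtype.val_injective
      (σ.injective.comp Subtype.val_injective) (fun a => (mem_gainSet.1 a.2.1).1) (clsFun f σ k)
    have hc : pairViol (fun a : {s // s ∈ gainSet f σ ∧ cls f σ s = k} => a.1)
        (fun a => σ a.1) (clsFun f σ k) = #{s ∈ gainSet f σ | cls f σ s = k} := by
      have : ∀ a : {s // s ∈ gainSet f σ ∧ cls f σ s = k},
          ind (clsFun f σ k a.1 && !clsFun f σ k (σ a.1)) = 1 := by
        rintro ⟨s, hs, rfl⟩
        simp [hσ.clsFun_left hs, clsFun_right hs, ind]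
      rw [pairViol, sum_congr rfl fun a _ => this a, sum_const, card_univ, Fintype.card_subtype,
        nsmul_one]
      congr 2
      ext s
      simp
    rw [hc] at hp
    have hmark : IsMarking (clsFun f σ k) (mk k) := by
      refine fun x i => ⟨fun hi => (mem_filter.1 hi).2, fun hv => ?_⟩
      have hv' := hv
      rw [← viol_flipC] at hv'
      exact (hm x i (edgeViol_of_viol_clsFun hv).1).imp (fun h => mem_filter.2 ⟨h, hv⟩)
        (fun h => mem_filter.2 ⟨h, hv'⟩)
    exact hp.trans (mul_le_mul_of_nonneg_left (tal_le_cost hmark) (by norm_num))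
  have h2 : ∀ x, ∑ k ∈ K, Real.sqrt #(mk k x) ≤ Real.sqrt #(m x) := by
    intro x
    by_cases hne : ∃ k ∈ K, (mk k x).Nonempty
    · obtain ⟨k, hk, i, hi⟩ := hne
      rw [sum_eq_single k]
      · exact Real.sqrt_le_sqrt (by exact_mod_cast card_filter_le _ _)
      · intro k' _ hkk'
        have : mk k' x = ∅ := by
          rw [← not_nonempty_iff_eq_empty]
          rintro ⟨j, hj⟩
          exact hkk' ((edgeViol_of_viol_clsFun (mem_filter.1 hj).2).2.unique
            (edgeViol_of_viol_clsFun (mem_filter.1 hi).2).2)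
        rw [this]
        simp
      · exact fun h => absurd hk h
    · push Not at hne
      rw [sum_eq_zero]
      · exact Real.sqrt_nonneg _
      · intro k hk
        rw [hne k hk]
        simp
  have h3 : (#(gainSet f σ) : ℝ) ≤ 1458 * ∑ x, Real.sqrt #(m x) := by
    rw [card_eq_sum_card_image (cls f σ) (gainSet f σ)]
    push_cast
    refine (sum_le_sum h1).trans ?_
    rw [← mul_sum]
    simp only [cost]
    rw [sum_comm]
    gcongr with x
    exact h2 x
  obtain ⟨g, hg, hfg⟩ := hσ.exists_monotone
  have h4 : sInf {n : ℕ | ∃ g : (Fin d → Bool) → ℝ, MonotoneCube g ∧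
      n = Nat.card {x : Fin d → Bool // f x ≠ g x}} ≤ 2 * #(gainSet f σ) :=
    (Nat.sInf_le (show _ ∈ {n : ℕ | ∃ g : (Fin d → Bool) → ℝ, MonotoneCube g ∧
      n = Nat.card {x : Fin d → Bool // f x ≠ g x}} from ⟨g, fun x y hxy => hg hxy, rfl⟩)).trans hfg
  rw [distMono, div_mul_cancel₀ _ (by positivity)]
  have h5 : ((sInf {n : ℕ | ∃ g : (Fin d → Bool) → ℝ, MonotoneCube g ∧
      n = Nat.card {x : Fin d → Bool // f x ≠ g x}} : ℕ) : ℝ) ≤ 2 * #(gainSet f σ) := by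
    exact_mod_cast h4
  linarith

/-! ### Random coordinate sets and captures -/

lemma sum_weight_ite {d : ℕ} (p : ℝ) (i : Fin d) (W : Finset (Fin d)) (hi : i ∉ W) :
    ∑ S : Finset (Fin d), (if i ∈ S ∧ Disjoint S W then p ^ #S * (1 - p) ^ (d - #S) else 0) =
      p * (1 - p) ^ #W := by
  have hR : #(univ \ insert i W) + (#W + 1) = d := by
    rw [← card_insert_of_notMem hi, card_sdiff_add_card_eq_card (subset_univ _), card_univ,
      Fintype.card_fin]
  have hiR : i ∉ univ \ insert i W := by simp
  have hset : (univ.filter fun S : Finset (Fin d) => i ∈ S ∧ Disjoint S W) =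
      (univ \ insert i W).powerset.image (insert i) := by
    ext S
    simp only [mem_filter, mem_univ, true_and, mem_image, mem_powerset]
    constructor
    · rintro ⟨h1, h2⟩
      refine ⟨S.erase i, fun j hj => ?_, insert_erase h1⟩
      rw [mem_erase] at hj
      simp only [mem_sdiff, mem_univ, true_and, mem_insert, not_or]
      exact ⟨hj.1, disjoint_left.1 h2 hj.2⟩
    · rintro ⟨T, hT, rfl⟩
      refine ⟨mem_insert_self _ _, disjoint_insert_left.2 ⟨hi, disjoint_left.2 fun j hj hjW => ?_⟩⟩
      have := hT hj
      simp [hjW] at this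
  have hinj : Set.InjOn (insert i) ((univ \ insert i W).powerset : Set (Finset (Fin d))) := by
    intro S hS T hT hST
    have h1 : i ∉ S := fun h => hiR (mem_powerset.1 hS h)
    have h2 : i ∉ T := fun h => hiR (mem_powerset.1 hT h)
    rw [← erase_insert h1, hST, erase_insert h2]
  rw [← sum_filter, hset, sum_image hinj]
  have h1 : ∀ T ∈ (univ \ insert i W).powerset,
      p ^ #(insert i T) * (1 - p) ^ (d - #(insert i T)) =
        p * (1 - p) ^ #W * (p ^ #T * (1 - p) ^ (#(univ \ insert i W) - #T)) := by
    intro T hT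
    have h2 : i ∉ T := fun h => hiR (mem_powerset.1 hT h)
    have h3 := card_le_card (mem_powerset.1 hT)
    rw [card_insert_of_notMem h2,
      show d - (#T + 1) = #W + (#(univ \ insert i W) - #T) by omega, pow_succ, pow_add]
    ring
  rw [sum_congr rfl h1, ← mul_sum, sum_pow_mul_eq_add_pow]
  simp

variable {d : ℕ}

/-- The directions of the violated edges at `x`. -/
noncomputable def violDirs (f : (Fin d → Bool) → ℝ) (x : Fin d → Bool) : Finset (Fin d) :=
  open Classical in {i | EdgeViol f x i}

lemma mem_violDirs {f : (Fin d → Bool) → ℝ} {x : Fin d → Bool} {i : Fin d} :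
    i ∈ violDirs f x ↔ EdgeViol f x i := by
  simp [violDirs]

lemma edgeViol_flipC {f : (Fin d → Bool) → ℝ} {x : Fin d → Bool} {i : Fin d} :
    EdgeViol f (flipC x i) i ↔ EdgeViol f x i := by
  unfold EdgeViol
  rw [flipC_flipC, flipC_apply_self]
  cases x i <;> simp

/-- The directions of the violated edges at `x` whose other endpoint has no more violated
edges. -/
noncomputable def topDirs (f : (Fin d → Bool) → ℝ) (x : Fin d → Bool) : Finset (Fin d) :=
  {i ∈ violDirs f x | #(violDirs f (flipC x i)) ≤ #(violDirs f x)}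

lemma topDirs_cover {f : (Fin d → Bool) → ℝ} (x : Fin d → Bool) (i : Fin d)
    (h : EdgeViol f x i) : i ∈ topDirs f x ∨ i ∈ topDirs f (flipC x i) := by
  simp only [topDirs, mem_filter, mem_violDirs, edgeViol_flipC, flipC_flipC, h, true_and]
  exact le_total _ _

/-- The probability that `x` is captured by a random set of density `p`. -/
noncomputable def captureProb (f : (Fin d → Bool) → ℝ) (p : ℝ) (x : Fin d → Bool) : ℝ :=
  open Classical in
  ∑ S : Finset (Fin d), if Capture d f S x then p ^ #S * (1 - p) ^ (d - #S) else 0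

lemma captureProb_nonneg (f : (Fin d → Bool) → ℝ) {p : ℝ} (hp0 : 0 ≤ p) (hp1 : p ≤ 1)
    (x : Fin d → Bool) : 0 ≤ captureProb f p x := by
  refine sum_nonneg fun S _ => ?_
  have : 0 ≤ 1 - p := by linarith
  split_ifs <;> positivity

lemma le_captureProb (f : (Fin d → Bool) → ℝ) {p : ℝ} (hp0 : 0 ≤ p) (hp1 : p ≤ 1)
    (x : Fin d → Bool) :
    #(topDirs f x) * (p * (1 - p) ^ (2 * (#(violDirs f x) - 1))) ≤ captureProb f p x := by
  classical
  have hq : 0 ≤ 1 - p := by linarith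
  set W : Fin d → Finset (Fin d) :=
    fun i => (violDirs f x).erase i ∪ (violDirs f (flipC x i)).erase i with hW
  have h1 : ∀ i ∈ topDirs f x, p * (1 - p) ^ (2 * (#(violDirs f x) - 1)) ≤
      ∑ S : Finset (Fin d), (if i ∈ S ∧ Disjoint S (W i) then p ^ #S * (1 - p) ^ (d - #S) else 0) := by
    intro i hi
    rw [topDirs, mem_filter] at hi
    rw [sum_weight_ite p i (W i) (by simp [hW])]
    refine mul_le_mul_of_nonneg_left (pow_le_pow_of_le_one hq (by linarith) ?_) hp0
    refine (card_union_le _ _).trans ?_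
    have h2 : i ∈ violDirs f (flipC x i) := by
      rw [mem_violDirs, edgeViol_flipC, ← mem_violDirs]
      exact hi.1
    rw [card_erase_of_mem hi.1, card_erase_of_mem h2]
    omega
  have h2 : ∀ S : Finset (Fin d), ∑ i ∈ topDirs f x,
      (if i ∈ S ∧ Disjoint S (W i) then p ^ #S * (1 - p) ^ (d - #S) else 0) ≤
        if Capture d f S x then p ^ #S * (1 - p) ^ (d - #S) else 0 := by
    intro S
    by_cases hex : ∃ i ∈ topDirs f x, i ∈ S ∧ Disjoint S (W i)
    · obtain ⟨i, hi, hiS, hSW⟩ := hex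
      have hcap : Capture d f S x := by
        refine ⟨i, hiS, mem_violDirs.1 (mem_filter.1 hi).1, fun j hj hji hv => ?_⟩
        exact disjoint_left.1 hSW hj
          (mem_union_right _ (mem_erase.2 ⟨hji, mem_violDirs.2 hv⟩))
      rw [if_pos hcap, sum_eq_single i]
      · rw [if_pos ⟨hiS, hSW⟩]
      · intro j hj hji
        rw [if_neg]
        rintro ⟨hjS, -⟩
        exact disjoint_left.1 hSW hjS
          (mem_union_left _ (mem_erase.2 ⟨hji, (mem_filter.1 hj).1⟩))
      · exact fun h => absurd hi h
    · push Not at hex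
      rw [sum_eq_zero fun i hi => if_neg fun h => hex i hi h.1 h.2]
      split_ifs <;> positivity
  calc _ = ∑ i ∈ topDirs f x, p * (1 - p) ^ (2 * (#(violDirs f x) - 1)) := by
        rw [sum_const, nsmul_eq_mul]
    _ ≤ _ := sum_le_sum h1
    _ ≤ _ := by
        rw [sum_comm]
        exact sum_le_sum fun S _ => h2 S

lemma exp_neg_one_le_pow (t : ℕ) (ht : 0 < t) :
    Real.exp (-1) ≤ (1 - 1 / (t : ℝ)) ^ (t - 1) := by
  obtain ⟨n, rfl⟩ : ∃ n, t = n + 1 := ⟨t - 1, by omega⟩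
  rcases Nat.eq_zero_or_pos n with rfl | hn
  · simp
  have hn' : (0 : ℝ) < n := by exact_mod_cast hn
  rw [Nat.add_sub_cancel, Real.exp_neg]
  have h1 : (1 - 1 / ((n + 1 : ℕ) : ℝ)) = (1 + 1 / (n : ℝ))⁻¹ := by
    push_cast
    field_simp
    ring
  rw [h1, inv_pow]
  apply inv_anti₀ (by positivity)
  calc (1 + 1 / (n : ℝ)) ^ n ≤ Real.exp (1 / n) ^ n := by
        apply pow_le_pow_left₀ (by positivity)
        linarith [Real.add_one_le_exp (1 / (n : ℝ))]
    _ = Real.exp 1 := by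
        rw [← Real.exp_nat_mul]
        congr 1
        field_simp

lemma ratio_le_captureProb (f : (Fin d → Bool) → ℝ) (x : Fin d → Bool) :
    Real.exp (-4) * (#(topDirs f x) / #(violDirs f x)) ≤
      captureProb f (1 / 2 ^ Nat.log 2 #(violDirs f x)) x := by
  set v := #(violDirs f x) with hv
  set t := 2 ^ Nat.log 2 v with ht
  have ht0 : 0 < t := by positivity
  have hp1 : 1 / (t : ℝ) ≤ 1 := by
    rw [div_le_one (by exact_mod_cast ht0)]
    exact_mod_cast ht0
  have key := le_captureProb f (p := 1 / (t : ℝ)) (by positivity) hp1 x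
  have hcast : (2 : ℝ) ^ Nat.log 2 v = t := by simp [ht]
  rw [hcast]
  refine le_trans ?_ key
  rcases Nat.eq_zero_or_pos v with h0 | h0
  · have : #(topDirs f x) = 0 := Nat.le_zero.1 ((card_filter_le _ _).trans h0.le)
    simp [this]
  have h1 : t ≤ v := Nat.pow_log_le_self 2 h0.ne'
  have h2 : v < t * 2 := by
    have := Nat.lt_pow_succ_log_self (b := 2) (by norm_num) v
    rwa [pow_succ] at this
  have hq : 0 ≤ 1 - 1 / (t : ℝ) := by linarith
  have h3 : Real.exp (-4) ≤ (1 - 1 / (t : ℝ)) ^ (2 * (v - 1)) := by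
    calc Real.exp (-4) = Real.exp (-1) ^ 4 := by
          rw [← Real.exp_nat_mul]
          norm_num
      _ ≤ ((1 - 1 / (t : ℝ)) ^ (t - 1)) ^ 4 :=
          pow_le_pow_left₀ (Real.exp_pos _).le (exp_neg_one_le_pow t ht0) 4
      _ = (1 - 1 / (t : ℝ)) ^ ((t - 1) * 4) := by rw [pow_mul]
      _ ≤ _ := pow_le_pow_of_le_one hq (by simp) (by omega)
  have h4 : 1 / (v : ℝ) ≤ 1 / t :=
    one_div_le_one_div_of_le (by exact_mod_cast ht0) (by exact_mod_cast h1)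
  calc Real.exp (-4) * (#(topDirs f x) / v) = #(topDirs f x) * (1 / v * Real.exp (-4)) := by ring
    _ ≤ _ := by gcongr

lemma sum_muF (f : (Fin d → Bool) → ℝ) (p : ℝ) :
    ∑ S : Finset (Fin d), p ^ S.card * (1 - p) ^ (d - S.card) * muF d f S =
      (∑ x, captureProb f p x) / 2 ^ d := by
  classical
  simp only [captureProb]
  rw [sum_comm, sum_div]
  refine sum_congr rfl fun S _ => ?_
  rw [muF, Nat.card_eq_fintype_card, Fintype.card_subtype, ← sum_filter, sum_const, nsmul_eq_mul]
  ring

lemma sum_card_violDirs_le (f : (Fin d → Bool) → ℝ) :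
    ∑ x, #(violDirs f x) ≤ 2 * totViol d f := by
  classical
  have hflip : ∀ (x : Fin d → Bool) (i j : Fin d), flipC x i = flipC x j → i = j := by
    intro x i j h
    by_contra hij
    have := congrFun h i
    rw [flipC_apply_self, flipC_apply_ne x hij] at this
    simp at this
  set T : Finset ((Fin d → Bool) × (Fin d → Bool)) :=
    {p | IsEdge p.1 p.2 ∧ f p.1 > f p.2} with hT
  have hTc : totViol d f = #T := by
    rw [totViol, Nat.card_eq_fintype_card, Fintype.card_subtype]
  set A : Finset ((Fin d → Bool) × Fin d) :=
    {p | p.1 p.2 = false ∧ f p.1 > f (flipC p.1 p.2)} with hA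
  set B : Finset ((Fin d → Bool) × Fin d) :=
    {p | p.1 p.2 = true ∧ f (flipC p.1 p.2) > f p.1} with hB
  have h1 : ∑ x, #(violDirs f x) ≤ #(A ∪ B) := by
    rw [← card_sigma]
    refine card_le_card_of_injOn (fun p => (p.1, p.2)) ?_ ?_
    · rintro ⟨x, i⟩ h
      have h : EdgeViol f x i := by simpa [mem_violDirs] using h
      simpa [hA, hB, EdgeViol] using h
    · rintro ⟨x, i⟩ _ ⟨y, j⟩ _ h
      simp only [Prod.mk.injEq] at h
      obtain ⟨rfl, rfl⟩ := h
      rfl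
  have h2 : #A ≤ #T := by
    refine card_le_card_of_injOn (fun p => (p.1, flipC p.1 p.2)) ?_ ?_
    · rintro ⟨x, i⟩ h
      have h : x i = false ∧ f (flipC x i) < f x := by simpa [hA] using h
      have : IsEdge x (flipC x i) :=
        ⟨i, h.1, by simp [flipC_apply_self, h.1], fun j hj => (flipC_apply_ne x hj).symm⟩
      simpa [hT] using ⟨this, h.2⟩
    · rintro ⟨x, i⟩ _ ⟨y, j⟩ _ h
      simp only [Prod.mk.injEq] at h
      obtain ⟨rfl, h⟩ := h
      rw [hflip _ _ _ h]
  have h3 : #B ≤ #T := by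
    refine card_le_card_of_injOn (fun p => (flipC p.1 p.2, p.1)) ?_ ?_
    · rintro ⟨x, i⟩ h
      have h : x i = true ∧ f x < f (flipC x i) := by simpa [hB] using h
      have : IsEdge (flipC x i) x :=
        ⟨i, by simp [flipC_apply_self, h.1], h.1, fun j hj => flipC_apply_ne x hj⟩
      simpa [hT] using ⟨this, h.2⟩
    · rintro ⟨x, i⟩ _ ⟨y, j⟩ _ h
      simp only [Prod.mk.injEq] at h
      obtain ⟨h, rfl⟩ := h
      rw [hflip _ _ _ h]
  have h4 := card_union_le A B
  rw [hTc]
  omega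

lemma sq_sum_sqrt_topDirs_le (f : (Fin d → Bool) → ℝ) :
    (∑ x, Real.sqrt #(topDirs f x)) ^ 2 ≤
      (∑ x, (#(topDirs f x) : ℝ) / #(violDirs f x)) * ∑ x, (#(violDirs f x) : ℝ) := by
  refine sum_sq_le_sum_mul_sum_of_sq_le_mul univ (fun x _ => by positivity)
    (fun x _ => by positivity) fun x _ => ?_
  rw [Real.sq_sqrt (by positivity)]
  rcases Nat.eq_zero_or_pos #(violDirs f x) with h0 | h0
  · have : #(topDirs f x) = 0 := Nat.le_zero.1 ((card_filter_le _ _).trans h0.le)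
    simp [this]
  · have : (#(violDirs f x) : ℝ) ≠ 0 := by positivity
    exact le_of_eq (by field_simp)

lemma sum_ratio_le (f : (Fin d → Bool) → ℝ) :
    Real.exp (-4) * ∑ x, (#(topDirs f x) : ℝ) / #(violDirs f x) ≤
      ∑ j ∈ range (Nat.log 2 d + 1), ∑ x, captureProb f (1 / 2 ^ j) x := by
  rw [mul_sum, sum_comm]
  refine sum_le_sum fun x _ => (ratio_le_captureProb f x).trans ?_
  refine single_le_sum (f := fun j => captureProb f (1 / 2 ^ j) x) (fun j _ => ?_) ?_
  · refine captureProb_nonneg f (by positivity) ?_ x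
    rw [div_le_one (by positivity)]
    exact one_le_pow₀ (by norm_num)
  · rw [mem_range, Nat.lt_succ_iff]
    exact Nat.log_mono_right (card_finset_fin_le _)

lemma log_two_add_one_le {d : ℕ} (hd : 2 ≤ d) : (Nat.log 2 d + 1 : ℝ) ≤ 3 * Real.log d := by
  have h1 : Real.log 2 ≤ Real.log d := Real.log_le_log (by norm_num) (by exact_mod_cast hd)
  have h2 : (Nat.log 2 d : ℝ) * Real.log 2 ≤ Real.log d := by
    rw [← Real.log_pow]
    apply Real.log_le_log (by positivity)
    exact_mod_cast Nat.pow_log_le_self 2 (by omega)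
  have h3 := Real.log_two_gt_d9
  have h4 : (0 : ℝ) ≤ Nat.log 2 d := by positivity
  nlinarith

lemma mul_le_of_sq_le_mul {a b s K Q R V : ℝ} (ha : 0 < a) (hs : 0 < s) (hR : 0 ≤ R)
    (hK : 0 < K) (hQ : a ≤ K * Q) (hQRV : Q ^ 2 ≤ R * V) (hV : V * s ≤ b * a) :
    a * s ≤ K ^ 2 * b * R := by
  have h1 : a ^ 2 ≤ (K * Q) ^ 2 := pow_le_pow_left₀ ha.le hQ 2
  have h2 : a * (a * s) ≤ a * (K ^ 2 * b * R) := by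
    calc a * (a * s) = a ^ 2 * s := by ring
      _ ≤ (K * Q) ^ 2 * s := by gcongr
      _ = K ^ 2 * Q ^ 2 * s := by ring
      _ ≤ K ^ 2 * (R * V) * s := by gcongr
      _ = K ^ 2 * R * (V * s) := by ring
      _ ≤ K ^ 2 * R * (b * a) := by gcongr
      _ = _ := by ring
  exact le_of_mul_le_mul_left h2 ha

lemma mul_div_eq_of_sq_eq {c b s l K ε N : ℝ} (hb : 0 < b) (hs : 0 < s) (h : s ^ 2 = b * l)
    (hK : 0 < K) :
    3 * l * (c / (3 * K ^ 2) * ε / s * N) = c * (ε * N * s / (K ^ 2 * b)) := by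
  have : l = s ^ 2 / b := by
    rw [h]
    field_simp
  rw [this]
  field_simp

end CubeSort

/-- If `f` is `ε`-far from monotone but violates fewer than an `ε/√(d log d)` fraction of
the edges, then for some `t ∈ {1, 2, 4, …, 2^⌊log₂ d⌋}`, the expectation of `μ_f(S)` over
a random set `S` including each coordinate independently with probability `1/t` is
`Ω(ε/√(d log d))`. -/
theorem capture_expectation_lower_bound :
    ∃ C : ℝ, 0 < C ∧ ∀ d : ℕ, 2 ≤ d → ∀ ε : ℝ, 0 < ε → ε < 1 →
      ∀ f : (Fin d → Bool) → ℝ, distMono d f ≥ ε →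
        (totViol d f : ℝ) / (d * 2 ^ (d - 1)) < ε / Real.sqrt (d * Real.log d) →
        ∃ j : ℕ, j ≤ Nat.log 2 d ∧
          (∑ S : Finset (Fin d),
              (1 / (2 ^ j : ℝ)) ^ S.card * (1 - 1 / (2 ^ j : ℝ)) ^ (d - S.card) * muF d f S)
            ≥ C * ε / Real.sqrt (d * Real.log d) := by
  refine ⟨Real.exp (-4) / (3 * 2916 ^ 2), by positivity, fun d hd ε hε _ f hdist hviol => ?_⟩
  have hd0 : (0 : ℝ) < d := by exact_mod_cast (by omega : 0 < d)
  have hlog : 0 < Real.log d := Real.log_pos (by exact_mod_cast (by omega : 1 < d))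
  set s := Real.sqrt (d * Real.log d) with hs
  have hs0 : 0 < s := Real.sqrt_pos.2 (by positivity)
  have hs2 : s ^ 2 = d * Real.log d := Real.sq_sqrt (by positivity)
  set N : ℝ := 2 ^ d with hN
  have hN0 : 0 < N := by positivity
  have hNd : 2 * (2 : ℝ) ^ (d - 1) = N := by
    rw [hN, ← pow_succ', Nat.sub_add_cancel (by omega)]
  set Q := ∑ x, Real.sqrt (CubeSort.topDirs f x).card
  set R := ∑ x, ((CubeSort.topDirs f x).card : ℝ) / (CubeSort.violDirs f x).card
  set V := ∑ x, ((CubeSort.violDirs f x).card : ℝ) with hV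
  have hR0 : 0 ≤ R := Finset.sum_nonneg fun x _ => by positivity
  have hQ : ε * N ≤ 2916 * Q :=
    (mul_le_mul_of_nonneg_right hdist hN0.le).trans
      (CubeSort.distMono_le_sum_sqrt (by omega) f _ fun x i h => CubeSort.topDirs_cover x i h)
  have hQRV : Q ^ 2 ≤ R * V := CubeSort.sq_sum_sqrt_topDirs_le f
  have hVs : V * s ≤ ε * d * N := by
    have h1 : V ≤ 2 * totViol d f := by
      rw [hV]
      exact_mod_cast CubeSort.sum_card_violDirs_le f
    rw [div_lt_div_iff₀ (by positivity) hs0] at hviol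
    calc V * s ≤ 2 * totViol d f * s := by gcongr
      _ ≤ ε * d * (2 * 2 ^ (d - 1)) := by linarith
      _ = ε * d * N := by rw [hNd]
  have hR : ε * N * s ≤ 2916 ^ 2 * d * R :=
    CubeSort.mul_le_of_sq_le_mul (by positivity) hs0 hR0 (by norm_num) hQ hQRV
      (by linarith [hVs])
  by_contra! hcon
  have hlt : ∑ j ∈ Finset.range (Nat.log 2 d + 1), ∑ x, CubeSort.captureProb f (1 / 2 ^ j) x <
      ∑ j ∈ Finset.range (Nat.log 2 d + 1), Real.exp (-4) / (3 * 2916 ^ 2) * ε / s * N := by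
    refine Finset.sum_lt_sum_of_nonempty (by simp) fun j hj => ?_
    have h1 := hcon j (Nat.lt_succ_iff.1 (Finset.mem_range.1 hj))
    rwa [CubeSort.sum_muF, div_lt_iff₀ hN0] at h1
  rw [Finset.sum_const, Finset.card_range, nsmul_eq_mul, Nat.cast_add, Nat.cast_one] at hlt
  have hfin : Real.exp (-4) * R < Real.exp (-4) * R := by
    calc Real.exp (-4) * R ≤ _ := CubeSort.sum_ratio_le f
      _ < _ := hlt
      _ ≤ 3 * Real.log d * (Real.exp (-4) / (3 * 2916 ^ 2) * ε / s * N) :=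
          mul_le_mul_of_nonneg_right (CubeSort.log_two_add_one_le hd) (by positivity)
      _ = Real.exp (-4) * (ε * N * s / (2916 ^ 2 * d)) :=
          CubeSort.mul_div_eq_of_sq_eq hd0 hs0 hs2 (by norm_num)
      _ ≤ Real.exp (-4) * R :=
          mul_le_mul_of_nonneg_left ((div_le_iff₀ (by positivity)).2 (by linarith)) (by positivity)
  exact lt_irrefl _ hfin
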